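/- Let q be a prime power, n > 1 and 1 ≤ d < n integers, and let ℓ > 1 be an integer dividing q^n − 1 such that n ≥ 2d + 2·(|I_d| + 1)·(log ℓ / log q), where I_d is the set of monic irreducible polynomials in 𝔽_q[x] whose degree divides d. Then there exists α ∈ 𝔽_{q^n} of degree n over 𝔽_q such that for every g ∈ I_d, the element g(α) is an ℓ-th power in 𝔽_{q^n}^×. -/

import Mathlib

/-- `irredDvdSet F d` is the set `I_d` of monic irreducible polynomials over `F`
whose degree divides `d`. -/
def irredDvdSet (F : Type*) [Field F] (d : ℕ) : Set (Polynomial F) :=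
  {p | p.Monic ∧ Irreducible p ∧ p.natDegree ∣ d}

section
open Polynomial

lemma wk_kummer_irred {k : Type*} [Field k] {ℓ : ℕ} (hℓ : 0 < ℓ) {ζ : k}
    (hζ : IsPrimitiveRoot ζ ℓ) {a : k} (ha : a ≠ 0)
    (h : ∀ p : ℕ, p.Prime → p ∣ ℓ → ∀ b : k, b ^ p ≠ a) :
    Irreducible (X ^ ℓ - C a : k[X]) := by
  have hmon : (X ^ ℓ - C a : k[X]).Monic := monic_X_pow_sub_C a hℓ.ne'
  have hdeg : (X ^ ℓ - C a : k[X]).natDegree = ℓ := natDegree_X_pow_sub_C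
  let K := AlgebraicClosure k
  obtain ⟨T, hT⟩ : ∃ T : K, T ^ ℓ = algebraMap k K a :=
    IsAlgClosed.exists_pow_nat_eq _ hℓ
  have hIntg : IsIntegral k T := (isAlgebraic_iff_isIntegral).1 (Algebra.IsAlgebraic.isAlgebraic T)
  set μ := minpoly k T with hμ
  have hdvd : μ ∣ X ^ ℓ - C a := minpoly.dvd k T (by simp [hT])
  have hμm : μ.Monic := minpoly.monic hIntg
  set s := μ.natDegree with hs
  have hspos : 0 < s := minpoly.natDegree_pos hIntg
  have hsle : s ≤ ℓ := by rw [← hdeg]; exact natDegree_le_of_dvd hdvd hmon.ne_zero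
  by_cases hsl : s = ℓ
  · have : μ = X ^ ℓ - C a :=
      (eq_of_dvd_of_natDegree_le_of_leadingCoeff hdvd (by rw [hdeg, ← hsl])
        (by rw [hμm.leadingCoeff, hmon.leadingCoeff]))
    rw [← this]
    exact minpoly.irreducible hIntg
  exfalso
  -- b^ℓ = a^s
  obtain ⟨b, hb⟩ : ∃ b : k, b ^ ℓ = a ^ s := by
    have hsplit : (μ.map (algebraMap k K)).Splits := IsAlgClosed.splits _
    refine ⟨(-1) ^ s * μ.coeff 0, ?_⟩
    apply (algebraMap k K).injective
    have h0 : algebraMap k K (μ.coeff 0) = (-1) ^ s * (μ.map (algebraMap k K)).roots.prod := by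
      rw [← coeff_map, hsplit.coeff_zero_eq_prod_roots_of_monic (hμm.map _), natDegree_map]
    have hroots : ∀ β ∈ (μ.map (algebraMap k K)).roots, β ^ ℓ = algebraMap k K a := by
      intro β hβ
      have h1 := (mem_roots'.1 hβ).2
      have h2 : (X ^ ℓ - C a : k[X]).map (algebraMap k K) ∈ Ideal.span {μ.map (algebraMap k K)} :=
        Ideal.mem_span_singleton.2 (Polynomial.map_dvd _ hdvd)
      have h3 := IsRoot.dvd h1 (Polynomial.map_dvd (algebraMap k K) hdvd)
      simpa [IsRoot, sub_eq_zero] using h3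
    have hcard : Multiset.card (μ.map (algebraMap k K)).roots = s := by
      rw [← hsplit.natDegree_eq_card_roots, natDegree_map]
    rw [map_pow, map_mul, h0, ← mul_assoc, map_pow, map_neg, map_one, ← mul_pow]
    have h11 : (-1 * -1 : K) = 1 := by norm_num
    rw [h11, one_pow, one_mul]
    conv_lhs => rw [← Multiset.map_id (map (algebraMap k K) μ).roots]
    rw [← Multiset.prod_map_pow]
    simp only [id]
    rw [Multiset.map_congr rfl hroots]
    simp [hcard]
  set g := Nat.gcd s ℓ with hg
  have hgpos : 0 < g := Nat.gcd_pos_of_pos_left _ hspos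
  obtain ⟨t, ht⟩ : g ∣ ℓ := Nat.gcd_dvd_right s ℓ
  have hgs : g ≤ s := Nat.le_of_dvd hspos (Nat.gcd_dvd_left s ℓ)
  have ht1 : t ≠ 1 := by rintro rfl; apply hsl; rw [mul_one] at ht; omega
  have hb0 : b ≠ 0 := by
    rintro rfl; rw [zero_pow hℓ.ne'] at hb; exact pow_ne_zero _ ha hb.symm
  -- a^g = c^ℓ
  obtain ⟨c, hc⟩ : ∃ c : k, c ^ ℓ = a ^ g := by
    refine ⟨b ^ (Nat.gcdA s ℓ) * a ^ (Nat.gcdB s ℓ), ?_⟩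
    have := Nat.gcd_eq_gcd_ab s ℓ
    rw [← zpow_natCast a g, this, mul_pow, zpow_add₀ ha, zpow_mul, zpow_mul, ← zpow_natCast,
      ← zpow_natCast _ ℓ, ← zpow_mul, ← zpow_mul, mul_comm _ (ℓ : ℤ), zpow_mul, zpow_natCast, hb,
      zpow_natCast, mul_comm _ (ℓ : ℤ), zpow_mul, zpow_natCast]
  have hroot : (c ^ t / a) ^ g = 1 := by
    rw [div_pow, ← pow_mul, mul_comm t g, ← ht, hc, div_self (pow_ne_zero _ ha)]
  have htpos : 0 < t := by
    rcases Nat.eq_zero_or_pos t with h0 | h0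
    · rw [h0] at ht; omega
    · exact h0
  have hζg : IsPrimitiveRoot (ζ ^ t) g := hζ.pow hℓ (by rw [ht, mul_comm])
  haveI : NeZero g := ⟨hgpos.ne'⟩
  obtain ⟨i, -, hi⟩ := hζg.eq_pow_of_pow_eq_one hroot
  have hζ0 : ζ ≠ 0 := hζ.ne_zero hℓ.ne'
  obtain ⟨p, hp, u, hu⟩ := Nat.exists_prime_and_dvd ht1
  refine h p hp (by rw [ht, hu]; exact ⟨g * u, by ring⟩) ((c / ζ ^ i) ^ u) ?_
  rw [← pow_mul, mul_comm u p, ← hu, div_pow, ← pow_mul, mul_comm i t, pow_mul, hi]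
  have hc0 : c ≠ 0 := by
    rintro rfl; rw [zero_pow hℓ.ne'] at hc; exact pow_ne_zero _ ha hc.symm
  field_simp

/-- circulant-like matrix of multiplication by `∑ A i T^i` where `fX T^ℓ = fY`. -/
noncomputable def wkMat {R : Type*} [CommRing R] {ℓ : ℕ} [NeZero ℓ] (fX fY : R) (A : Fin ℓ → R) :
    Matrix (Fin ℓ) (Fin ℓ) R :=
  fun a b => if a ≤ b then fX * A (b - a) else fY * A (b - a)

lemma wkMat_sum {R S : Type*} [CommRing R] [CommRing S] {ℓ : ℕ} [NeZero ℓ] (fX fY : R)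
    (A : Fin ℓ → R) (ψ : R →+* S) (τ : S) (hτ : ψ fX * τ ^ ℓ = ψ fY) (a : Fin ℓ) :
    ∑ b : Fin ℓ, ψ (wkMat fX fY A a b) * τ ^ (b : ℕ) =
      ψ fX * τ ^ (a : ℕ) * ∑ i : Fin ℓ, ψ (A i) * τ ^ (i : ℕ) := by
  rw [Finset.mul_sum, ← Equiv.sum_comp (Equiv.addLeft a)]
  refine Finset.sum_congr rfl fun i _ => ?_
  simp only [Equiv.coe_addLeft, wkMat, add_sub_cancel_left]
  by_cases h : (a : ℕ) + i < ℓ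
  · have hv : ((a + i : Fin ℓ) : ℕ) = a + i := Fin.val_add_eq_of_add_lt h
    have hle : a ≤ a + i := by rw [Fin.le_def, hv]; omega
    rw [if_pos hle, hv, map_mul, pow_add]; ring
  · have hv : ((a + i : Fin ℓ) : ℕ) = a + i - ℓ := by
      rw [Fin.val_add_eq_ite, if_pos (by omega)]
    have hle : ¬ a ≤ a + i := by
      rw [Fin.le_def, hv]; have := i.2; have := a.2; omega
    rw [if_neg hle, hv, map_mul, ← hτ]
    have : τ ^ (a : ℕ) * τ ^ (i : ℕ) = τ ^ ℓ * τ ^ ((a : ℕ) + i - ℓ) := by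
      rw [← pow_add, ← pow_add]; congr 1; omega
    linear_combination ψ fX * ψ (A i) * this.symm

lemma wkMat_det_ne_zero {R : Type*} [CommRing R] [IsDomain R] {ℓ : ℕ} [NeZero ℓ] (fX fY : R)
    (hfX : fX ≠ 0) (hfY : fY ≠ 0) (A : Fin ℓ → R) (hA : A ≠ 0) {ζ : R} (hζ : IsPrimitiveRoot ζ ℓ)
    (h : ∀ p : ℕ, p.Prime → p ∣ ℓ → ∀ u v : R, v ≠ 0 → fX * u ^ p ≠ fY * v ^ p) :
    (wkMat fX fY A).det ≠ 0 := by
  intro hdet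
  obtain ⟨v, hv0, hv⟩ := Matrix.exists_vecMul_eq_zero_iff.2 hdet
  let k := FractionRing R
  have hinj : Function.Injective (algebraMap R k) := IsFractionRing.injective R k
  have hX0 : algebraMap R k fX ≠ 0 := by rwa [Ne, map_eq_zero_iff _ hinj]
  have hY0 : algebraMap R k fY ≠ 0 := by rwa [Ne, map_eq_zero_iff _ hinj]
  set a : k := algebraMap R k fY / algebraMap R k fX with ha
  have ha0 : a ≠ 0 := div_ne_zero hY0 hX0
  have hirr : Irreducible (X ^ ℓ - C a : k[X]) := by
    refine wk_kummer_irred (NeZero.pos ℓ) (hζ.map_of_injective hinj) ha0 ?_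
    intro p hp hpl b hb
    obtain ⟨x, y, hy, rfl⟩ := IsFractionRing.div_surjective (A := R) b
    have hy0 : y ≠ 0 := nonZeroDivisors.ne_zero hy
    have hy1 : algebraMap R k y ≠ 0 := by rwa [Ne, map_eq_zero_iff _ hinj]
    refine h p hp hpl x y hy0 (hinj ?_)
    rw [map_mul, map_mul, map_pow, map_pow]
    rw [ha, div_pow, div_eq_div_iff (pow_ne_zero _ hy1) hX0] at hb
    linear_combination hb
  haveI : Fact (Irreducible (X ^ ℓ - C a : k[X])) := ⟨hirr⟩
  let L := AdjoinRoot (X ^ ℓ - C a : k[X])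
  let τ : L := AdjoinRoot.root _
  let ψ : R →+* L := (AdjoinRoot.of _).comp (algebraMap R k)
  have hτ : τ ^ ℓ = AdjoinRoot.of _ a := by
    have := AdjoinRoot.eval₂_root (X ^ ℓ - C a : k[X])
    simpa [sub_eq_zero] using this
  have hτ' : ψ fX * τ ^ ℓ = ψ fY := by
    rw [hτ]; simp only [ψ, RingHom.comp_apply]; rw [← map_mul]
    exact congrArg _ (mul_div_cancel₀ _ hX0)
  have hlin : ∀ w : Fin ℓ → R, ∑ i : Fin ℓ, ψ (w i) * τ ^ (i : ℕ) = 0 → w = 0 := by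
    intro w hw
    let P : k[X] := ∑ i : Fin ℓ, C (algebraMap R k (w i)) * X ^ (i : ℕ)
    have hP : AdjoinRoot.mk (X ^ ℓ - C a : k[X]) P = 0 := by
      simp only [P, map_sum, map_mul, map_pow, AdjoinRoot.mk_C, AdjoinRoot.mk_X]
      exact hw
    rw [AdjoinRoot.mk_eq_zero] at hP
    have hPd : P.degree < ℓ := by
      refine (degree_sum_le _ _).trans_lt ?_
      rw [Finset.sup_lt_iff (by exact WithBot.bot_lt_coe ℓ)]
      intro i _
      exact (degree_C_mul_X_pow_le _ _).trans_lt (by exact_mod_cast i.2)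
    have hP0 : P = 0 := by
      refine eq_zero_of_dvd_of_degree_lt hP ?_
      rwa [degree_X_pow_sub_C (NeZero.pos ℓ)]
    funext i
    have := congrArg (fun q => coeff q (i : ℕ)) hP0
    simp only [P, finsetSum_coeff, coeff_C_mul, coeff_X_pow, coeff_zero] at this
    rw [Finset.sum_eq_single i] at this
    · simpa using this
    · intro j _ hj
      rw [if_neg (fun hh => hj (Fin.ext hh.symm))]; simp
    · simp
  have key : (∑ x : Fin ℓ, ψ (v x) * τ ^ (x : ℕ)) * (ψ fX * ∑ i : Fin ℓ, ψ (A i) * τ ^ (i : ℕ)) = 0 := by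
    have : ∀ x, ψ (v x) * τ ^ (x : ℕ) * (ψ fX * ∑ i : Fin ℓ, ψ (A i) * τ ^ (i : ℕ)) =
        ∑ b : Fin ℓ, ψ (v x * wkMat fX fY A x b) * τ ^ (b : ℕ) := by
      intro x
      have := wkMat_sum fX fY A ψ τ hτ' x
      simp only [map_mul, mul_assoc]
      rw [← Finset.mul_sum, this]; ring
    rw [Finset.sum_mul, Finset.sum_congr rfl fun x _ => this x, Finset.sum_comm]
    refine Finset.sum_eq_zero fun b _ => ?_
    rw [← Finset.sum_mul, ← map_sum]
    have := congrFun hv b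
    simp only [Matrix.vecMul, dotProduct, Pi.zero_apply] at this
    rw [this]; simp
  rcases mul_eq_zero.1 key with h1 | h1
  · exact hv0 (hlin v h1)
  rcases mul_eq_zero.1 h1 with h2 | h2
  · have : ψ fX = 0 := h2
    simp only [ψ, RingHom.comp_apply] at this
    exact hX0 ((map_eq_zero _).1 this)
  · exact hA (hlin A h2)


lemma wk_phi_inj {F : Type*} [Field F] {Q : ℕ} (P : F[X][X])
    (hP : P.natDegree < Q)
    (h : eval₂RingHom (expand F Q : F[X] →+* F[X]) X P = 0) : P = 0 := by
  ext i j
  have hQ : 0 < Q := by omega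
  by_cases hi : i < Q
  · rw [coe_eval₂RingHom, eval₂_eq_sum_range' _ hP] at h
    have h2 := congrArg (fun q => coeff q (j * Q + i)) h
    simp only [finsetSum_coeff, coeff_zero] at h2
    rw [Finset.sum_eq_single i] at h2
    · rw [coeff_mul_X_pow] at h2
      have : (expand F Q (P.coeff i)).coeff (j * Q) = (P.coeff i).coeff j := coeff_expand_mul hQ _ _
      rw [← this]; exact h2
    · intro b hb hbi
      rw [coeff_mul_X_pow']
      split_ifs with hle
      · change (expand F Q (P.coeff b)).coeff _ = 0
        rw [coeff_expand hQ, if_neg]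
        rintro ⟨t, ht⟩
        have hb' := Finset.mem_range.1 hb
        have h3 : j * Q + i = Q * t + b := by omega
        have h4 : (j * Q + i) % Q = i := by rw [Nat.mul_comm, Nat.mul_add_mod, Nat.mod_eq_of_lt hi]
        have h5 : (Q * t + b) % Q = b := by rw [Nat.mul_add_mod, Nat.mod_eq_of_lt hb']
        rw [h3, h5] at h4
        exact hbi h4
      · rfl
    · intro hn; exact absurd (Finset.mem_range.2 hi) hn
  · rw [coeff_eq_zero_of_natDegree_lt (lt_of_lt_of_le hP (not_lt.1 hi))]; simp

lemma wk_rootMultiplicity_pow {R : Type*} [CommRing R] [IsDomain R] {u : R[X]} (hu : u ≠ 0)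
    (x : R) (n : ℕ) : rootMultiplicity x (u ^ n) = n * rootMultiplicity x u := by
  induction n with
  | zero => simpa using rootMultiplicity_C (1 : R) x
  | succ n ih =>
    rw [pow_succ, rootMultiplicity_mul (mul_ne_zero (pow_ne_zero _ hu) hu), ih]; ring

lemma wk_nonvanish {F : Type*} [Field F] {ℓ Q B : ℕ} [NeZero ℓ] (f g : F[X]) (hf : f ≠ 0)
    (hfg : f * g ^ ℓ = expand F Q f) {ζ : F} (hζ : IsPrimitiveRoot ζ ℓ)
    (hmult : ∀ p : ℕ, p.Prime → p ∣ ℓ → ∃ θ : F, ¬ p ∣ f.rootMultiplicity θ)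
    (hB : ℓ * (B + f.natDegree) ≤ Q) (A : Fin ℓ → F[X][X]) (hA : ∀ i, (A i).natDegree < B)
    (hA0 : A ≠ 0) :
    ∑ i : Fin ℓ, eval₂RingHom (expand F Q : F[X] →+* F[X]) X (A i) * g ^ (i : ℕ) ≠ 0 := by
  intro hsum
  set φ := eval₂RingHom (expand F Q : F[X] →+* F[X]) X with hφ
  set fX : F[X][X] := f.map C with hfX
  set fY : F[X][X] := C f with hfY
  have hℓ : 0 < ℓ := NeZero.pos ℓ
  have hX0 : fX ≠ 0 := (Polynomial.map_ne_zero_iff C_injective).2 hf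
  have hY0 : fY ≠ 0 := C_ne_zero.2 hf
  have hφX : φ fX = f := by
    simp only [φ, fX, coe_eval₂RingHom, eval₂_map]
    have : ((expand F Q : F[X] →+* F[X]).comp C) = C := by ext a; simp
    rw [this, eval₂_C_X]
  have hφY : φ fY = expand F Q f := by simp [φ, fY]
  have hdet0 : (wkMat fX fY A).det ≠ 0 := by
    refine wkMat_det_ne_zero fX fY hX0 hY0 A hA0 (ζ := C (C ζ))
      (hζ.map_of_injective (f := (C.comp C : F →+* F[X][X])) (C_injective.comp C_injective)) ?_
    intro p hp hpl u v hv h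
    obtain ⟨θ, hθ⟩ := hmult p hp hpl
    have hu : u ≠ 0 := by
      rintro rfl
      rw [zero_pow hp.ne_zero, mul_zero] at h
      exact mul_ne_zero hY0 (pow_ne_zero _ hv) h.symm
    have h2 := congrArg (rootMultiplicity (C θ)) h
    rw [rootMultiplicity_mul (mul_ne_zero hX0 (pow_ne_zero _ hu)),
      rootMultiplicity_mul (mul_ne_zero hY0 (pow_ne_zero _ hv)), wk_rootMultiplicity_pow hu,
      wk_rootMultiplicity_pow hv, rootMultiplicity_C, zero_add, hfX,
      ← eq_rootMultiplicity_map C_injective] at h2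
    apply hθ
    have h3 : p ∣ f.rootMultiplicity θ + p * rootMultiplicity (C θ) u := by
      rw [h2]; exact dvd_mul_right _ _
    exact (Nat.dvd_add_left (dvd_mul_right _ _)).1 h3
  apply hdet0
  apply wk_phi_inj (Q := Q)
  · have hBpos : 0 < B := lt_of_le_of_lt (Nat.zero_le _) (hA ⟨0, hℓ⟩)
    have : (wkMat fX fY A).det.natDegree ≤ ℓ * (B - 1 + f.natDegree) := by
      rw [Matrix.det_apply]
      refine natDegree_sum_le_of_forall_le _ _ fun σ _ => ?_
      refine (natDegree_smul_le _ _).trans ?_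
      refine (natDegree_prod_le _ _).trans ?_
      refine (Finset.sum_le_card_nsmul _ _ (B - 1 + f.natDegree) ?_).trans (by simp)
      intro i _
      simp only [wkMat]
      have hXd : fX.natDegree ≤ f.natDegree := natDegree_map_le
      have hYd : fY.natDegree ≤ f.natDegree := by simp [fY]
      have hAd := hA (i - σ i)
      split_ifs
      · exact natDegree_mul_le.trans (by omega)
      · exact natDegree_mul_le.trans (by omega)
    refine this.trans_lt (lt_of_lt_of_le ?_ hB)
    exact Nat.mul_lt_mul_of_pos_left (by omega) hℓ
  · rw [← hφ, RingHom.map_det]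
    apply Matrix.exists_mulVec_eq_zero_iff.1
    refine ⟨fun b => g ^ (b : ℕ), ?_, ?_⟩
    · intro h0
      have := congrFun h0 ⟨0, hℓ⟩
      simp at this
    · funext a
      have := wkMat_sum fX fY A φ g (by rw [hφX, hφY, hfg]) a
      rw [hsum, mul_zero] at this
      simpa [Matrix.mulVec, dotProduct] using this


lemma wk_hasse_pow_dvd {F : Type*} [Field F] (f : F[X]) (N a : ℕ) :
    f ^ (N - a) ∣ hasseDeriv a (f ^ N) := by
  induction N generalizing a with
  | zero => simp
  | succ N ih =>
    rw [pow_succ', hasseDeriv_mul]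
    refine Finset.dvd_sum fun ij hij => ?_
    rw [Finset.HasAntidiagonal.mem_antidiagonal] at hij
    rcases Nat.eq_zero_or_pos ij.1 with h0 | h0
    · rw [h0, hasseDeriv_zero']
      have h1 : ij.2 = a := by omega
      rw [h1]
      by_cases hle : a ≤ N
      · rw [Nat.succ_sub hle, pow_succ']
        exact mul_dvd_mul_left _ (ih a)
      · rw [Nat.sub_eq_zero_of_le (by omega)]; simp
    · refine Dvd.dvd.mul_left ((pow_dvd_pow f ?_).trans (ih ij.2)) _
      omega

lemma wk_exists_W {F : Type*} [Field F] {f : F[X]} (hf : f.Monic) (N u : ℕ) (hu : u ≤ N) :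
    ∃ W : F[X] →ₗ[F] F[X], (∀ k, hasseDeriv u (f ^ N * k) = f ^ (N - u) * W k) ∧
      ∀ k B, k ∈ degreeLT F B → W k ∈ degreeLT F (B + u * f.natDegree) := by
  have h1 : ∀ a : ℕ, ∃ h : F[X], a ≤ u → hasseDeriv a (f ^ N) = f ^ (N - u) * h := by
    intro a
    by_cases ha : a ≤ u
    · obtain ⟨h, hh⟩ := (pow_dvd_pow f (show N - u ≤ N - a by omega)).trans (wk_hasse_pow_dvd f N a)
      exact ⟨h, fun _ => hh⟩
    · exact ⟨0, fun h => absurd h ha⟩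
  choose h hh using h1
  let W : F[X] →ₗ[F] F[X] := ∑ ij ∈ Finset.HasAntidiagonal.antidiagonal u,
    (LinearMap.mulLeft F (h ij.1)).comp (hasseDeriv ij.2)
  have hW : ∀ k, hasseDeriv u (f ^ N * k) = f ^ (N - u) * W k := by
    intro k
    rw [hasseDeriv_mul]
    simp only [W, LinearMap.sum_apply, LinearMap.comp_apply, LinearMap.mulLeft_apply,
      Finset.mul_sum]
    refine Finset.sum_congr rfl fun ij hij => ?_
    rw [Finset.HasAntidiagonal.mem_antidiagonal] at hij
    rw [hh ij.1 (by omega), mul_assoc]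
  refine ⟨W, hW, fun k B hk => ?_⟩
  rw [mem_degreeLT] at hk ⊢
  by_cases hW0 : W k = 0
  · rw [hW0, degree_zero]; exact WithBot.bot_lt_coe _
  have hk0 : k ≠ 0 := by rintro rfl; exact hW0 (map_zero W)
  rw [degree_eq_natDegree hW0]
  rw [degree_eq_natDegree hk0] at hk
  have hk' : k.natDegree < B := by exact_mod_cast hk
  have h2 := natDegree_hasseDeriv_le (f ^ N * k) u
  rw [hW k, (hf.pow _).natDegree_mul' hW0, (hf.pow _).natDegree_mul' hk0, hf.natDegree_pow,
    hf.natDegree_pow] at h2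
  have h3 : N * f.natDegree = (N - u) * f.natDegree + u * f.natDegree := by
    rw [← add_mul]; congr 1; omega
  have : (W k).natDegree < B + u * f.natDegree := by omega
  exact_mod_cast this

lemma wk_X_sub_C_pow_card {F : Type*} [Field F] [Fintype F] (α : F) :
    (X - C α : F[X]) ^ Fintype.card F = X ^ Fintype.card F - C α := by
  obtain ⟨p, hp⟩ := CharP.exists F
  obtain ⟨n, hp1, hn⟩ := FiniteField.card F p
  haveI := Fact.mk hp1
  rw [hn, sub_pow_char_pow, ← C_pow, ← hn, FiniteField.pow_card]

theorem wk_stepanov_core {F : Type*} [Field F] [Fintype F] {ℓ G M J B : ℕ} [NeZero ℓ]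
    (hQ : Fintype.card F = ℓ * G + 1) {f : F[X]} (hf : f.Monic) (c : F)
    {ζ : F} (hζ : IsPrimitiveRoot ζ ℓ)
    (hmult : ∀ p : ℕ, p.Prime → p ∣ ℓ → ∃ θ : F, ¬ p ∣ f.rootMultiplicity θ)
    (h1 : M * (B + M * f.natDegree + J) < ℓ * J * B)
    (h2 : ℓ * (B + f.natDegree) ≤ Fintype.card F) (h3 : M ≤ Fintype.card F)
    (s : Finset F) (hs : ∀ α ∈ s, (f.eval α) ^ G = c) :
    s.card * M ≤ M * f.natDegree + B + Fintype.card F * f.natDegree + J * Fintype.card F := by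
  classical
  set Q := Fintype.card F with hQdef
  set m := f.natDegree with hm
  set D := B + M * m + J with hD
  have hex : ∀ (i : Fin ℓ) (u : Fin M), ∃ W : F[X] →ₗ[F] F[X],
      (∀ k, hasseDeriv (u : ℕ) (f ^ (M + i * G) * k) = f ^ (M + i * G - u) * W k) ∧
      ∀ k B, k ∈ degreeLT F B → W k ∈ degreeLT F (B + u * f.natDegree) := fun i u =>
    wk_exists_W hf _ _ (by have := u.2; omega)
  choose W hW1 hW2 using hex
  let V := (Fin ℓ × Fin J) → degreeLT F B
  let Φ0 : Fin M → V →ₗ[F] F[X] := fun u => ∑ ij : Fin ℓ × Fin J,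
    c ^ (ij.1 : ℕ) • (LinearMap.mulLeft F (X ^ (ij.2 : ℕ) : F[X])).comp
      ((W ij.1 u).comp ((degreeLT F B).subtype.comp (LinearMap.proj ij)))
  have hΦ0 : ∀ u k, Φ0 u k = ∑ ij : Fin ℓ × Fin J,
      c ^ (ij.1 : ℕ) • (X ^ (ij.2 : ℕ) * W ij.1 u (k ij : F[X])) := by
    intro u k; simp [Φ0]; rfl
  have hΦmem : ∀ u k, Φ0 u k ∈ degreeLT F D := by
    intro u k
    rw [hΦ0]
    refine Submodule.sum_mem _ fun ij _ => Submodule.smul_mem _ _ ?_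
    have := hW2 ij.1 u (k ij) B (k ij).2
    rw [mem_degreeLT] at this ⊢
    by_cases h0 : W ij.1 u (k ij : F[X]) = 0
    · rw [h0, mul_zero, degree_zero]; exact WithBot.bot_lt_coe _
    · rw [degree_mul, degree_X_pow, degree_eq_natDegree h0]
      rw [degree_eq_natDegree h0] at this
      have h4 : (W ij.1 u (k ij : F[X])).natDegree < B + u * m := by exact_mod_cast this
      have h5 : (u : ℕ) * m ≤ M * m := Nat.mul_le_mul_right _ u.2.le
      have h6 := ij.2.2
      have : (ij.2 : ℕ) + (W ij.1 u (k ij : F[X])).natDegree < D := by omega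
      exact_mod_cast this
  let Φ : V →ₗ[F] (Fin M → degreeLT F D) :=
    LinearMap.pi fun u => (Φ0 u).codRestrict (degreeLT F D) (hΦmem u)
  have hfr : ∀ n, Module.finrank F (degreeLT F n) = n := fun n => by
    rw [(degreeLTEquiv F n).finrank_eq, Module.finrank_fin_fun]
  haveI hfd : ∀ n, Module.Finite F (degreeLT F n) := fun n =>
    Module.Finite.equiv (degreeLTEquiv F n).symm
  obtain ⟨k, hk, hk0⟩ : ∃ k ∈ LinearMap.ker Φ, k ≠ 0 := by
    apply Submodule.exists_mem_ne_zero_of_ne_bot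
    apply LinearMap.ker_ne_bot_of_finrank_lt
    rw [Module.finrank_pi_fintype, Module.finrank_pi_fintype]
    simp only [hfr, Finset.sum_const, Finset.card_univ, Fintype.card_prod, Fintype.card_fin,
      smul_eq_mul]
    exact h1
  have hker : ∀ u, Φ0 u k = 0 := by
    intro u
    have := congrFun (LinearMap.mem_ker.1 hk) u
    exact congrArg Subtype.val this
  set g := f ^ G with hg
  have hfg : f * g ^ ℓ = expand F Q f := by
    rw [FiniteField.expand_card, ← hQdef, hQ, hg]; ring
  let A : Fin ℓ → F[X][X] := fun i =>
    ∑ j : Fin J, ((k (i, j) : F[X]).map C) * C (X ^ (j : ℕ))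
  set R0 : F[X] := ∑ i : Fin ℓ, ∑ j : Fin J, (k (i, j) : F[X]) * g ^ (i : ℕ) * X ^ (j * Q : ℕ)
    with hR0
  have hkd : ∀ ij, (k ij : F[X]).degree < B := fun ij => mem_degreeLT.1 (k ij).2
  obtain ⟨ij0, hij0⟩ : ∃ ij, k ij ≠ 0 := Function.ne_iff.1 hk0
  have hBpos : 0 < B := by
    have := hkd ij0
    rw [degree_eq_natDegree (fun h => hij0 (Subtype.ext h))] at this
    have h' : (k ij0 : F[X]).natDegree < B := by exact_mod_cast this
    omega
  have hknd : ∀ ij, (k ij : F[X]).natDegree < B := fun ij => by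
    by_cases h0 : (k ij : F[X]) = 0
    · rw [h0]; simpa using hBpos
    · exact (natDegree_lt_iff_degree_lt h0).2 (hkd ij)
  have hA0 : A ≠ 0 := by
    intro h0
    apply hij0
    have h4 := congrFun h0 ij0.1
    apply Subtype.ext
    ext t
    have h5 := congrArg (fun P : F[X][X] => (P.coeff t).coeff ij0.2) h4
    simp only [A, finsetSum_coeff, coeff_mul_C, coeff_map, coeff_C_mul, coeff_X_pow, Pi.zero_apply,
      coeff_zero] at h5
    rw [Finset.sum_eq_single ij0.2] at h5
    · simpa using h5
    · intro b _ hb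
      rw [if_neg (fun h => hb (Fin.ext h.symm)), mul_zero]
    · simp
  have hA : ∀ i, (A i).natDegree < B := by
    intro i
    have : (A i).natDegree ≤ B - 1 := by
      refine natDegree_sum_le_of_forall_le _ _ fun j _ => ?_
      refine natDegree_mul_le.trans ?_
      have h4 : ((k (i, j) : F[X]).map (C : F →+* F[X])).natDegree ≤ (k (i, j) : F[X]).natDegree :=
        natDegree_map_le
      have := hknd (i, j)
      rw [natDegree_C]; omega
    omega
  have hR0ne : R0 ≠ 0 := by
    have := wk_nonvanish f g hf.ne_zero hfg hζ hmult h2 A hA hA0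
    convert this using 1
    rw [hR0]
    refine Finset.sum_congr rfl fun i _ => ?_
    simp only [A, map_sum, map_mul, Finset.sum_mul, coe_eval₂RingHom, eval₂_map, eval₂_C]
    refine Finset.sum_congr rfl fun j _ => ?_
    have h4 : ((expand F Q : F[X] →+* F[X]).comp C) = C := by ext a; simp
    rw [h4, eval₂_C_X]
    simp only [RingHom.coe_coe, map_pow, expand_X]
    rw [← pow_mul X Q, mul_comm Q]; ring
  have hR0d : R0.natDegree ≤ B + Q * m + J * Q := by
    refine natDegree_sum_le_of_forall_le _ _ fun i _ => ?_
    refine natDegree_sum_le_of_forall_le _ _ fun j _ => ?_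
    refine natDegree_mul_le.trans ?_
    rw [natDegree_X_pow]
    refine add_le_add (natDegree_mul_le.trans (add_le_add (hknd _).le ?_))
      (Nat.mul_le_mul_right _ j.2.le)
    rw [hg, ← pow_mul, hf.natDegree_pow, ← hm]
    refine Nat.mul_le_mul_right _ ?_
    have : G * (i : ℕ) ≤ G * ℓ := Nat.mul_le_mul_left _ i.2.le
    rw [hQ]; linarith
  have hdvd : ∀ α ∈ s, (X - C α) ^ M ∣ f ^ M * R0 := by
    intro α hα
    have hc := hs α hα
    set P : F[X] := ∑ i : Fin ℓ, ∑ j : Fin J,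
      α ^ (j : ℕ) • (f ^ (M + i * G) * (k (i, j) : F[X])) with hP
    have e1 : (X - C α) ^ M ∣ f ^ M * R0 - P := by
      rw [hR0, hP, Finset.mul_sum, ← Finset.sum_sub_distrib]
      refine Finset.dvd_sum fun i _ => ?_
      rw [Finset.mul_sum, ← Finset.sum_sub_distrib]
      refine Finset.dvd_sum fun j _ => ?_
      have e2 : f ^ M * ((k (i, j) : F[X]) * g ^ (i : ℕ) * X ^ (j * Q : ℕ)) -
          α ^ (j : ℕ) • (f ^ (M + i * G) * (k (i, j) : F[X])) =
          (f ^ (M + i * G) * (k (i, j) : F[X])) * ((X ^ Q) ^ (j : ℕ) - (C α) ^ (j : ℕ)) := by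
        rw [smul_eq_C_mul, C_pow, hg, ← pow_mul, ← pow_mul, pow_add, mul_comm Q, mul_comm G]; ring
      rw [e2]
      refine Dvd.dvd.mul_left ?_ _
      refine dvd_trans ?_ (sub_dvd_pow_sub_pow _ _ _)
      rw [hQdef, ← wk_X_sub_C_pow_card]
      exact pow_dvd_pow _ h3
    have e3 : (X - C α) ^ M ∣ P := by
      rw [X_sub_C_pow_dvd_iff, X_pow_dvd_iff]
      intro u hu
      rw [← taylor_apply, taylor_coeff, hP]
      simp only [map_sum, map_smul, eval_finsetSum, eval_smul]
      have e4 := congrArg (eval α) (hker ⟨u, hu⟩)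
      rw [hΦ0, Fintype.sum_prod_type] at e4
      simp only [eval_finsetSum, eval_smul, eval_mul, eval_pow, eval_X, eval_zero, smul_eq_mul] at e4
      have e5 : ∀ (i : Fin ℓ) (j : Fin J),
          α ^ (j : ℕ) • eval α (hasseDeriv u (f ^ (M + i * G) * (k (i, j) : F[X]))) =
          eval α f ^ (M - u) * (c ^ (i : ℕ) * (α ^ (j : ℕ) *
            eval α (W i ⟨u, hu⟩ (k (i, j) : F[X])))) := by
        intro i j
        rw [hW1 i ⟨u, hu⟩ (k (i, j))]
        have e6 : M + i * G - u = (M - u) + G * i := by rw [mul_comm G]; omega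
        simp only [eval_mul, eval_pow, e6, smul_eq_mul]
        rw [pow_add, pow_mul, hc]; ring
      simp only [e5, ← Finset.mul_sum]
      simp only [Finset.mul_sum] at e4 ⊢
      simp only [← Finset.mul_sum] at e4 ⊢
      rw [e4, mul_zero]
    have := dvd_add e1 e3
    simpa using this
  have hprod : ∏ α ∈ s, (X - C α) ^ M ∣ f ^ M * R0 := by
    refine Finset.prod_dvd_of_coprime ?_ hdvd
    intro a _ b _ hab
    exact (pairwise_coprime_X_sub_C (s := (id : F → F)) Function.injective_id hab).pow
  have hne : f ^ M * R0 ≠ 0 := mul_ne_zero (pow_ne_zero _ hf.ne_zero) hR0ne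
  have hle := natDegree_le_of_dvd hprod hne
  rw [natDegree_prod_of_monic _ _ fun α _ => (monic_X_sub_C α).pow M] at hle
  simp only [natDegree_pow, natDegree_X_sub_C, mul_one, Finset.sum_const, smul_eq_mul] at hle
  rw [natDegree_mul (pow_ne_zero _ hf.ne_zero) hR0ne, hf.natDegree_pow, ← hm] at hle
  omega


lemma wk_stepanov_count {F : Type*} [Field F] [Fintype F] {ℓ G a : ℕ} [NeZero ℓ]
    (hQ : Fintype.card F = ℓ * G + 1) (ha : Fintype.card F = a ^ 2) {f : F[X]} (hf : f.Monic)
    (c : F) {ζ : F} (hζ : IsPrimitiveRoot ζ ℓ)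
    (hmult : ∀ p : ℕ, p.Prime → p ∣ ℓ → ∃ θ : F, ¬ p ∣ f.rootMultiplicity θ)
    (ha0 : 4 * ℓ * (ℓ * f.natDegree + 2) ≤ a)
    (s : Finset F) (hs : ∀ α ∈ s, (f.eval α) ^ G = c) :
    ℓ * s.card ≤ a ^ 2 + (4 * ℓ * (ℓ * f.natDegree + 2) + f.natDegree + 2) * a := by
  set m := f.natDegree with hm
  set c0 := 4 * ℓ * (ℓ * m + 2) with hc0
  have hℓ : 1 ≤ ℓ := Nat.one_le_iff_ne_zero.2 (NeZero.ne ℓ)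
  have haG : a ^ 2 = ℓ * G + 1 := by rw [← ha, hQ]
  have hℓm : ℓ * m + 2 ≤ c0 := by rw [hc0]; nlinarith
  have hℓa : ℓ ≤ a := by refine le_trans ?_ ha0; rw [hc0]; nlinarith [Nat.zero_le (ℓ * m)]
  have ha8 : 8 ≤ a := by refine le_trans ?_ ha0; rw [hc0]; nlinarith [Nat.zero_le (ℓ * m)]
  have hmG : m ≤ G := by
    by_contra h
    push Not at h
    have : ℓ * G ≤ ℓ * m := Nat.mul_le_mul_left _ h.le
    nlinarith
  obtain ⟨B, hB⟩ := Nat.exists_eq_add_of_le hmG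
  have hℓB : ℓ * B = a ^ 2 - 1 - ℓ * m := by
    rw [haG, hB, mul_add]; omega
  have hbig : ℓ * m + 1 ≤ a := by omega
  have hℓB' : ℓ * B + 1 + ℓ * m = a ^ 2 := by rw [haG, hB]; ring
  have key := wk_stepanov_core (M := ℓ * a) (J := a + c0) (B := B) hQ hf c hζ hmult ?_ ?_ ?_ s hs
  · rw [← hm, ha] at key
    have hBa : B ≤ a ^ 2 := by nlinarith
    have h1 : (ℓ * s.card) * a ≤ (a ^ 2 + (c0 + m + 2) * a) * a := by
      have : ℓ * a * m ≤ a * a := by nlinarith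
      nlinarith
    exact Nat.le_of_mul_le_mul_right h1 (by omega)
  · rw [← hm]
    have h1 : ℓ * (a + c0) * B = a * (ℓ * B) + c0 * (ℓ * B) := by ring
    have h2 : c0 * (ℓ * B) = ℓ * (4 * (ℓ * m + 2) * (ℓ * B)) := by rw [hc0]; ring
    rw [h1, h2]
    have h3 : ℓ * a * (B + ℓ * a * m + (a + c0)) = a * (ℓ * B) + ℓ * (a * (ℓ * m * a + a + c0)) := by
      ring
    rw [h3]
    have h4 : a * (ℓ * m * a + a + c0) < 4 * (ℓ * m + 2) * (ℓ * B) := by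
      have h5 : a * (ℓ * m * a + a + c0) ≤ a * a * (ℓ * m + 2) := by nlinarith
      have h6 : a * a < 4 * (ℓ * B) := by nlinarith
      calc _ ≤ a * a * (ℓ * m + 2) := h5
        _ < 4 * (ℓ * B) * (ℓ * m + 2) := Nat.mul_lt_mul_of_pos_right h6 (by omega)
        _ = _ := by ring
    have := Nat.mul_lt_mul_of_pos_left h4 (show 0 < ℓ by omega)
    omega
  · rw [← hm, ha, haG, hB]; nlinarith
  · rw [ha]; nlinarith

theorem wk_stepanov_char {L : Type*} [Field L] [Fintype L] {ℓ a : ℕ}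
    (hℓ : ℓ ∣ Fintype.card L - 1) (ha : Fintype.card L = a ^ 2) {f : L[X]} (hf : f.Monic)
    (ψ : MulChar L ℂ) (hψ : ψ ^ ℓ = 1) (hψ1 : ψ ≠ 1)
    (hmult : ∀ p : ℕ, p.Prime → p ∣ ℓ → ∃ θ : L, ¬ p ∣ f.rootMultiplicity θ)
    (ha0 : 4 * ℓ * (ℓ * f.natDegree + 2) ≤ a) :
    ‖∑ α : L, ψ (f.eval α)‖ ≤ (4 * ℓ * (ℓ * f.natDegree + 2) + f.natDegree + 2) * a + f.natDegree := by
  classical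
  have hcard : 1 < Fintype.card L := Fintype.one_lt_card
  obtain ⟨G, hG⟩ := hℓ
  have hQ : Fintype.card L = ℓ * G + 1 := by omega
  have hℓ0 : ℓ ≠ 0 := by rintro rfl; simp at hG; omega
  have hG0 : G ≠ 0 := by rintro rfl; simp at hG; omega
  haveI : NeZero ℓ := ⟨hℓ0⟩
  obtain ⟨γ, hγ⟩ := IsCyclic.exists_generator (α := Lˣ)
  have hoγ : orderOf γ = ℓ * G := by
    rw [orderOf_eq_card_of_forall_mem_zpowers hγ, Nat.card_eq_fintype_card, Fintype.card_units, hG]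
  set η : ℂ := ψ γ with hη
  have hηℓ : η ^ ℓ = 1 := by
    rw [hη, ← MulChar.pow_apply' _ hℓ0, hψ, MulChar.one_apply_coe]
  have hpowγ : ∀ x : Lˣ, ∃ k : ℕ, γ ^ k = x := fun x => by
    have := hγ x
    rwa [← mem_powers_iff_mem_zpowers] at this
  have hη1 : η ≠ 1 := by
    intro h
    apply hψ1
    ext x
    obtain ⟨k, rfl⟩ := hpowγ x
    rw [MulChar.one_apply_coe, Units.val_pow_eq_pow_val, map_pow, ← hη, h, one_pow]
  have hsum : ∑ i ∈ Finset.range ℓ, η ^ i = 0 := by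
    have := geom_sum_mul η ℓ
    rw [hηℓ, sub_self] at this
    exact (mul_eq_zero.1 this).resolve_right (sub_ne_zero.2 hη1)
  have hnη : ‖η‖ = 1 := Complex.norm_eq_one_of_pow_eq_one hηℓ hℓ0
  set ζ : L := (γ : L) ^ G with hζd
  have hζ : IsPrimitiveRoot ζ ℓ := by
    have h1 : IsPrimitiveRoot (γ : L) (ℓ * G) := by
      rw [← hoγ, ← orderOf_units]; exact IsPrimitiveRoot.orderOf _
    exact h1.pow (by positivity) (by ring)
  have hpt : ∀ y : L, ψ y = ∑ i ∈ Finset.range ℓ, if y ^ G = ζ ^ i then η ^ i else 0 := by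
    intro y
    by_cases hy : y = 0
    · rw [hy, MulChar.map_zero, zero_pow hG0]
      rw [Finset.sum_eq_zero]
      intro i _
      rw [if_neg]
      intro h
      exact pow_ne_zero i (hζ.ne_zero hℓ0) h.symm
    · obtain ⟨k, hk⟩ := hpowγ (Units.mk0 y hy)
      have hk' : (γ : L) ^ k = y := by
        rw [← Units.val_pow_eq_pow_val, hk, Units.val_mk0]
      have e1 : ψ y = η ^ (k % ℓ) := by
        rw [← hk', map_pow, ← hη, pow_eq_pow_mod k hηℓ]
      have e2 : y ^ G = ζ ^ (k % ℓ) := by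
        rw [← hk', ← pow_mul, mul_comm, pow_mul, ← hζd, pow_eq_pow_mod k hζ.pow_eq_one]
      have hkl : k % ℓ < ℓ := Nat.mod_lt _ (by omega)
      rw [Finset.sum_eq_single (k % ℓ), if_pos e2, e1]
      · intro b hb hbk
        rw [if_neg]
        intro h
        rw [e2] at h
        exact hbk (hζ.pow_inj hkl (Finset.mem_range.1 hb) h).symm
      · intro h; exact absurd (Finset.mem_range.2 hkl) h
  let S : ℕ → Finset L := fun i => Finset.univ.filter fun α => (f.eval α) ^ G = ζ ^ i
  set m := f.natDegree with hm
  set C := 4 * ℓ * (ℓ * m + 2) + m + 2 with hC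
  have hS : ∀ i, ℓ * (S i).card ≤ a ^ 2 + C * a := fun i =>
    wk_stepanov_count hQ ha hf (ζ ^ i) hζ hmult ha0 (S i) (fun α hα => (Finset.mem_filter.1 hα).2)
  have hsumψ : ∑ α : L, ψ (f.eval α) = ∑ i ∈ Finset.range ℓ, ((S i).card : ℂ) * η ^ i := by
    simp only [hpt]
    rw [Finset.sum_comm]
    refine Finset.sum_congr rfl fun i _ => ?_
    rw [← Finset.sum_filter, Finset.sum_const, nsmul_eq_mul]
  have hcount : a ^ 2 ≤ (∑ i ∈ Finset.range ℓ, (S i).card) + m := by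
    have h1 : (Finset.univ : Finset L) ⊆ (Finset.range ℓ).biUnion S ∪ f.roots.toFinset := by
      intro α _
      by_cases h0 : f.eval α = 0
      · refine Finset.mem_union_right _ ?_
        rw [Multiset.mem_toFinset, mem_roots hf.ne_zero]; exact h0
      · refine Finset.mem_union_left _ ?_
        have h2 : ψ (f.eval α) ≠ 0 := by
          intro h
          have := (IsUnit.mk0 _ h0).map ψ
          rw [h] at this
          exact not_isUnit_zero this
        rw [hpt] at h2
        obtain ⟨i, hi, h3⟩ := Finset.exists_ne_zero_of_sum_ne_zero h2
        refine Finset.mem_biUnion.2 ⟨i, hi, Finset.mem_filter.2 ⟨Finset.mem_univ _, ?_⟩⟩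
        by_contra h4
        exact h3 (if_neg h4)
    have h2 := Finset.card_le_card h1
    rw [Finset.card_univ, ha] at h2
    refine h2.trans ((Finset.card_union_le _ _).trans (add_le_add Finset.card_biUnion_le ?_))
    exact (Multiset.toFinset_card_le _).trans (card_roots' f)
  have hmain : (ℓ : ℝ) * ‖∑ α : L, ψ (f.eval α)‖ ≤ ℓ * ((C : ℝ) * a + m) := by
    have h1 : (ℓ : ℂ) * ∑ α : L, ψ (f.eval α) =
        - ∑ i ∈ Finset.range ℓ, (((a ^ 2 + C * a : ℝ) - ℓ * (S i).card : ℝ) : ℂ) * η ^ i := by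
      rw [hsumψ]
      push_cast
      simp only [sub_mul, Finset.sum_sub_distrib, ← Finset.mul_sum, hsum, mul_assoc]
      simp
    have h2 : ‖(ℓ : ℂ) * ∑ α : L, ψ (f.eval α)‖ ≤
        ∑ i ∈ Finset.range ℓ, ((a ^ 2 + C * a : ℝ) - ℓ * (S i).card) := by
      rw [h1, norm_neg]
      refine (norm_sum_le _ _).trans (Finset.sum_le_sum fun i _ => ?_)
      rw [norm_mul, norm_pow, hnη, one_pow, mul_one, Complex.norm_real, Real.norm_eq_abs,
        abs_of_nonneg]
      have : ((ℓ * (S i).card : ℕ) : ℝ) ≤ ((a ^ 2 + C * a : ℕ) : ℝ) := by exact_mod_cast hS i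
      push_cast at this
      linarith
    rw [norm_mul, Complex.norm_natCast] at h2
    refine h2.trans ?_
    rw [Finset.sum_sub_distrib, Finset.sum_const, Finset.card_range, ← Finset.mul_sum, nsmul_eq_mul,
      ← mul_sub]
    refine mul_le_mul_of_nonneg_left ?_ (by positivity)
    have : ((a ^ 2 : ℕ) : ℝ) ≤ (((∑ i ∈ Finset.range ℓ, (S i).card) + m : ℕ) : ℝ) := by
      exact_mod_cast hcount
    push_cast at this
    linarith
  have hpos : (0 : ℝ) < ℓ := by positivity
  have := le_of_mul_le_mul_left hmain hpos
  rw [hC] at this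
  push_cast at this
  exact this


/-- power sum growth controls the size of each term -/
lemma wk_psum_bound {ι : Type*} [Fintype ι] (z : ι → ℂ) (A R : ℝ) (hR : 0 < R) (k0 : ℕ)
    (h : ∀ k, k0 ≤ k → ‖∑ i, z i ^ k‖ ≤ A * R ^ k) (i0 : ι) : ‖z i0‖ ≤ R := by
  classical
  set P : ℂ[X] := ∏ w ∈ (Finset.univ.image z).erase (z i0), (X - C w) with hP
  have hP0 : ∀ i, z i ≠ z i0 → P.eval (z i) = 0 := by
    intro i hi
    rw [hP, eval_prod]
    refine Finset.prod_eq_zero (i := z i) ?_ (by simp)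
    exact Finset.mem_erase.2 ⟨hi, Finset.mem_image_of_mem _ (Finset.mem_univ _)⟩
  have hP1 : P.eval (z i0) ≠ 0 := by
    rw [hP, eval_prod, Finset.prod_ne_zero_iff]
    intro w hw
    have := (Finset.mem_erase.1 hw).1
    simp only [eval_sub, eval_X, eval_C]
    exact sub_ne_zero.2 (Ne.symm this)
  set m : ℕ := (Finset.univ.filter fun i => z i = z i0).card with hm
  have hmpos : 0 < m := Finset.card_pos.2 ⟨i0, by simp⟩
  have key : ∀ k, ∑ j ∈ Finset.range (P.natDegree + 1), P.coeff j * ∑ i, z i ^ (k + j) =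
      m * (z i0 ^ k * P.eval (z i0)) := by
    intro k
    simp only [Finset.mul_sum]
    rw [Finset.sum_comm]
    have : ∀ i, ∑ j ∈ Finset.range (P.natDegree + 1), P.coeff j * z i ^ (k + j) =
        if z i = z i0 then z i0 ^ k * P.eval (z i0) else 0 := by
      intro i
      have e : ∑ j ∈ Finset.range (P.natDegree + 1), P.coeff j * z i ^ (k + j) =
          z i ^ k * P.eval (z i) := by
        rw [eval_eq_sum_range, Finset.mul_sum]
        refine Finset.sum_congr rfl fun j _ => ?_
        ring
      rw [e]
      split_ifs with hi
      · rw [hi]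
      · rw [hP0 i hi, mul_zero]
    simp only [this]
    rw [← Finset.sum_filter, Finset.sum_const, nsmul_eq_mul]
  by_contra hlt
  push Not at hlt
  set A' : ℝ := ∑ j ∈ Finset.range (P.natDegree + 1), ‖P.coeff j‖ * (A * R ^ j) with hA'
  have hb : ∀ k, k0 ≤ k → m * (‖z i0‖ ^ k * ‖P.eval (z i0)‖) ≤ A' * R ^ k := by
    intro k hk
    have e := congrArg norm (key k)
    rw [norm_mul, norm_mul, norm_pow, Complex.norm_natCast] at e
    rw [← e, hA', Finset.sum_mul]
    refine (norm_sum_le _ _).trans (Finset.sum_le_sum fun j _ => ?_)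
    rw [norm_mul]
    have := h (k + j) (by omega)
    calc ‖P.coeff j‖ * ‖∑ i, z i ^ (k + j)‖ ≤ ‖P.coeff j‖ * (A * R ^ (k + j)) :=
          mul_le_mul_of_nonneg_left this (norm_nonneg _)
      _ = _ := by rw [pow_add]; ring
  have hx : 1 < ‖z i0‖ / R := (one_lt_div hR).2 hlt
  have hc : 0 < (m : ℝ) * ‖P.eval (z i0)‖ := by
    have := norm_pos_iff.2 hP1
    positivity
  obtain ⟨k, hk⟩ := ((tendsto_pow_atTop_atTop_of_one_lt hx).eventually_gt_atTop
    (A' / (m * ‖P.eval (z i0)‖))).and (Filter.eventually_ge_atTop k0) |>.exists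
  have h1 := hb k hk.2
  have h2 := hk.1
  rw [div_lt_iff₀ hc, div_pow, div_mul_eq_mul_div, lt_div_iff₀ (by positivity)] at h2
  linarith

lemma wk_psum_bound_mul {ι : Type*} [Fintype ι] (z : ι → ℂ) (A R : ℝ) (hR : 0 < R) (s k0 : ℕ)
    (hs : s ≠ 0)
    (h : ∀ k, k0 ≤ k → ‖∑ i, z i ^ (s * k)‖ ≤ A * R ^ (s * k)) (i0 : ι) : ‖z i0‖ ≤ R := by
  have := wk_psum_bound (fun i => z i ^ s) A (R ^ s) (by positivity) k0
    (fun k hk => by simpa only [← pow_mul] using h k hk) i0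
  rw [norm_pow] at this
  exact le_of_pow_le_pow_left₀ hs hR.le this

/-- From the recurrence `N c_N = ∑_{j=1}^N S_j c_{N-j}` with `c` finitely supported. -/
lemma wk_newton (n : ℕ) (c S : ℕ → ℂ) (hc0 : c 0 = 1) (hcn : ∀ N, n < N → c N = 0)
    (hrec : ∀ N : ℕ, (N : ℂ) * c N = ∑ j ∈ Finset.range N, c j * S (N - j)) :
    ∃ ω : Fin n → ℂ, ∀ r, 1 ≤ r → S r = - ∑ i, ω i ^ r := by
  classical
  set P : ℂ[X] := ∑ i ∈ Finset.range (n + 1), C (c (n - i)) * X ^ i with hP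
  have hcoef : ∀ i, i ≤ n → P.coeff i = c (n - i) := by
    intro i hi
    rw [hP, finsetSum_coeff, Finset.sum_eq_single i]
    · simp
    · intro b _ hb
      simp [coeff_X_pow, hb.symm]
    · intro h; exact absurd (Finset.mem_range.2 (by omega)) h
  have hdeg : P.natDegree ≤ n := by
    refine natDegree_sum_le_of_forall_le _ _ fun i hi => ?_
    refine (natDegree_C_mul_X_pow_le _ _).trans ?_
    have := Finset.mem_range.1 hi; omega
  have hPn : P.coeff n = 1 := by rw [hcoef n le_rfl, Nat.sub_self, hc0]
  have hmon : P.Monic := monic_of_natDegree_le_of_coeff_eq_one n hdeg hPn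
  have hnd : P.natDegree = n := le_antisymm hdeg (le_natDegree_of_ne_zero (by rw [hPn]; simp))
  have hcard : P.roots.card = n := by
    rw [← hnd]; exact ((IsAlgClosed.splits P).natDegree_eq_card_roots).symm
  obtain ⟨ω, hω⟩ : ∃ ω : Fin n → ℂ, Finset.univ.val.map ω = P.roots := by
    obtain ⟨l, hl⟩ := Quot.exists_rep P.roots
    have hl' : (l : Multiset ℂ) = P.roots := hl
    have hlen : l.length = n := by rw [← hcard, ← hl']; rfl
    subst hlen
    refine ⟨l.get, ?_⟩
    rw [← hl']
    simp
  have hes : ∀ k, MvPolynomial.aeval ω (MvPolynomial.esymm (Fin n) ℂ k) = (-1) ^ k * c k := by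
    intro k
    rw [MvPolynomial.aeval_esymm_eq_multiset_esymm, hω]
    by_cases hk : k ≤ n
    · have := coeff_eq_esymm_roots_of_card (p := P) (by rw [hcard, hnd]) (k := n - k)
        (by rw [hnd]; omega)
      rw [hmon.leadingCoeff, hnd, hcoef _ (by omega)] at this
      have e : n - (n - k) = k := by omega
      rw [e, one_mul] at this
      rw [this, ← mul_assoc, ← mul_pow]
      simp
    · rw [hcn k (by omega), mul_zero, Multiset.esymm, Multiset.powersetCard_eq_empty]
      · simp
      · rw [hcard]; omega
  refine ⟨ω, fun r => ?_⟩
  induction r using Nat.strong_induction_on with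
  | _ r ih =>
    intro hr
    have h1 := congrArg (MvPolynomial.aeval ω) (MvPolynomial.mul_esymm_eq_sum (Fin n) ℂ r)
    simp only [map_mul, map_natCast, map_pow, map_neg, map_one, map_sum, hes,
      MvPolynomial.psum, MvPolynomial.aeval_X] at h1
    have h2 : ∑ a ∈ Finset.HasAntidiagonal.antidiagonal r with a.1 < r,
        (-1 : ℂ) ^ a.1 * ((-1) ^ a.1 * c a.1) * ∑ i, ω i ^ a.2 =
        ∑ j ∈ Finset.range r, c j * ∑ i, ω i ^ (r - j) := by
      rw [Finset.sum_filter, Finset.Nat.sum_antidiagonal_eq_sum_range_succ_mk,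
        Finset.sum_range_succ]
      simp only [lt_irrefl, if_false, add_zero]
      refine Finset.sum_congr rfl fun j hj => ?_
      rw [if_pos (Finset.mem_range.1 hj), ← mul_assoc, ← mul_pow]
      simp
    rw [h2] at h1
    have h3 : (r : ℂ) * c r = - ∑ j ∈ Finset.range r, c j * ∑ i, ω i ^ (r - j) := by
      have h4 : ((-1 : ℂ) ^ r) * (-1) ^ r = 1 := by rw [← mul_pow]; simp
      calc (r : ℂ) * c r = (-1) ^ r * ((r : ℂ) * ((-1) ^ r * c r)) := by
            linear_combination (-(r : ℂ) * c r) * h4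
        _ = _ := by rw [h1, pow_succ]; linear_combination
                      (-∑ j ∈ Finset.range r, c j * ∑ i, ω i ^ (r - j)) * h4
    rw [hrec r] at h3
    obtain ⟨r, rfl⟩ : ∃ t, r = t + 1 := ⟨r - 1, by omega⟩
    rw [Finset.sum_range_succ', Finset.sum_range_succ'] at h3
    rw [neg_add, ← Finset.sum_neg_distrib] at h3
    have h5 : ∑ k ∈ Finset.range r, c (k + 1) * S (r + 1 - (k + 1)) =
        ∑ k ∈ Finset.range r, -(c (k + 1) * ∑ i, ω i ^ (r + 1 - (k + 1))) := by
      refine Finset.sum_congr rfl fun k hk => ?_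
      have := Finset.mem_range.1 hk
      rw [ih _ (by omega) (by omega), mul_neg]
    rw [h5, hc0] at h3
    simpa using h3


/-- the resultant of `f` and `h` -/
noncomputable def wkRes {K : Type*} [Field K] (f h : K[X]) : K :=
  resultant f h f.natDegree h.natDegree

lemma wkRes_spec {K : Type*} [Field K] {f : K[X]} (hf : f.Monic) (h : K[X]) :
    algebraMap K (AlgebraicClosure K) (wkRes f h) =
      ((f.map (algebraMap K (AlgebraicClosure K))).roots.map fun θ => aeval θ h).prod := by
  set φ := algebraMap K (AlgebraicClosure K) with hφ
  rw [wkRes, ← resultant_map_map, ← natDegree_map φ (p := f),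
    resultant_eq_prod_eval _ _ _ natDegree_map_le (IsAlgClosed.splits _), (hf.map φ).leadingCoeff,
    one_pow, one_mul]
  congr 1
  refine Multiset.map_congr rfl fun θ _ => ?_
  rw [eval_map_algebraMap]

lemma wkRes_mul {K : Type*} [Field K] {f : K[X]} (hf : f.Monic) (h g : K[X]) :
    wkRes f (h * g) = wkRes f h * wkRes f g := by
  apply (algebraMap K (AlgebraicClosure K)).injective
  rw [map_mul, wkRes_spec hf, wkRes_spec hf, wkRes_spec hf, ← Multiset.prod_map_mul]
  simp only [map_mul]

lemma wkRes_one {K : Type*} [Field K] {f : K[X]} (hf : f.Monic) :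
    wkRes f 1 = 1 := by
  apply (algebraMap K (AlgebraicClosure K)).injective
  rw [wkRes_spec hf]; simp

lemma wkRes_pow {K : Type*} [Field K] {f : K[X]} (hf : f.Monic) (h : K[X]) (k : ℕ) :
    wkRes f (h ^ k) = wkRes f h ^ k := by
  induction k with
  | zero => simp [wkRes_one hf]
  | succ k ih => rw [pow_succ, wkRes_mul hf, ih, pow_succ]

lemma wkRes_congr {K : Type*} [Field K] {f ρ : K[X]} (hf : f.Monic)
    (hρ : ∀ θ : AlgebraicClosure K, aeval θ f = 0 → aeval θ ρ = 0) {h g : K[X]}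
    (hd : ρ ∣ h - g) : wkRes f h = wkRes f g := by
  apply (algebraMap K (AlgebraicClosure K)).injective
  rw [wkRes_spec hf, wkRes_spec hf]
  congr 1
  refine Multiset.map_congr rfl fun θ hθ => ?_
  rw [mem_roots (hf.map _).ne_zero, IsRoot, eval_map_algebraMap] at hθ
  obtain ⟨k, hk⟩ := hd
  have := congrArg (aeval θ) hk
  rw [map_mul, hρ θ hθ, zero_mul, map_sub] at this
  exact sub_eq_zero.1 this

lemma wkRes_coprime {K : Type*} [Field K] {f ρ : K[X]} (hf : f.Monic)
    (hρ : ∀ θ : AlgebraicClosure K, aeval θ ρ = 0 → aeval θ f = 0) {u : K[X]}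
    (hu : wkRes f u ≠ 0) : IsCoprime u ρ := by
  rw [isCoprime_iff_aeval_ne_zero_of_isAlgClosed K (AlgebraicClosure K)]
  intro θ
  by_contra h
  push Not at h
  apply hu
  apply (algebraMap K (AlgebraicClosure K)).injective
  rw [wkRes_spec hf, map_zero]
  refine Multiset.prod_eq_zero (Multiset.mem_map.2 ⟨θ, ?_, h.1⟩)
  rw [mem_roots (hf.map _).ne_zero, IsRoot, eval_map_algebraMap]
  exact hρ θ h.2

lemma wkRes_minpoly {K L : Type*} [Field K] [Finite K] [Field L] [Algebra K L] [Finite L]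
    {f : K[X]} (hf : f.Monic) (α : L) :
    wkRes f (minpoly K α) ^ (Module.finrank K L / (minpoly K α).natDegree) =
      (-1) ^ (f.natDegree * Module.finrank K L) * Algebra.norm K (aeval α f) := by
  classical
  haveI : Module.Finite K L := Module.Finite.of_finite
  set P := minpoly K α with hP
  have hIntg : IsIntegral K α := Algebra.IsIntegral.isIntegral α
  have hPm : P.Monic := minpoly.monic hIntg
  have hfin : Module.finrank K (IntermediateField.adjoin K {α}) = P.natDegree :=
    IntermediateField.adjoin.finrank hIntg
  have htower := Module.finrank_mul_finrank K (IntermediateField.adjoin K {α}) L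
  rw [hfin] at htower
  have hPpos : 0 < P.natDegree := minpoly.natDegree_pos hIntg
  have hdiv : Module.finrank K L / P.natDegree =
      Module.finrank (IntermediateField.adjoin K {α}) L := by
    rw [← htower]; exact Nat.mul_div_cancel_left _ hPpos
  set g := IntermediateField.AdjoinSimple.gen K α with hg
  have hag : algebraMap (IntermediateField.adjoin K {α}) L g = α :=
    IntermediateField.AdjoinSimple.algebraMap_gen K α
  have h1 : aeval α f = algebraMap (IntermediateField.adjoin K {α}) L (aeval g f) := by
    rw [← aeval_algebraMap_apply, hag]
  rw [h1, ← Algebra.norm_norm (S := IntermediateField.adjoin K {α}), Algebra.norm_algebraMap,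
    map_pow, ← hdiv]
  have h2 : wkRes f P = (-1) ^ (f.natDegree * P.natDegree) * Algebra.norm K (aeval g f) := by
    rw [wkRes, resultant_comm]
    congr 1
    apply (algebraMap K (AlgebraicClosure K)).injective
    have h3 := wkRes_spec hPm f
    rw [wkRes] at h3
    rw [h3]
    rw [Algebra.norm_eq_prod_embeddings K (AlgebraicClosure K)]
    have hsep : IsSeparable K α := Algebra.IsSeparable.isSeparable K α
    have hPg : minpoly K (IntermediateField.adjoin.powerBasis hIntg).gen = P := by
      rw [IntermediateField.adjoin.powerBasis_gen, IntermediateField.minpoly_gen]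
    let e := (IntermediateField.adjoin.powerBasis hIntg).liftEquiv' (B := AlgebraicClosure K)
    letI : Fintype { y // y ∈ (P.map (algebraMap K (AlgebraicClosure K))).roots.toFinset } :=
      inferInstance
    have hroots : (P.map (algebraMap K (AlgebraicClosure K))).roots.toFinset.val =
        (P.map (algebraMap K (AlgebraicClosure K))).roots := by
      rw [Multiset.toFinset_val, Multiset.dedup_eq_self]
      exact nodup_roots (Separable.map hsep)
    rw [← hroots]
    change ∏ θ ∈ (P.map (algebraMap K (AlgebraicClosure K))).roots.toFinset, aeval θ f = _
    symm
    refine Finset.prod_bij (fun σ _ => σ g) ?_ ?_ ?_ ?_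
    · intro σ _
      rw [Multiset.mem_toFinset, mem_roots (hPm.map _).ne_zero, IsRoot, eval_map_algebraMap,
        aeval_algHom_apply]
      have : aeval g P = 0 := by
        rw [← hPg, IntermediateField.adjoin.powerBasis_gen]; exact minpoly.aeval _ _
      rw [this, map_zero]
    · intro σ _ τ _ h
      apply (IntermediateField.adjoin.powerBasis hIntg).algHom_ext
      rw [IntermediateField.adjoin.powerBasis_gen]; exact h
    · intro θ hθ
      rw [Multiset.mem_toFinset, mem_roots (hPm.map _).ne_zero, IsRoot, eval_map_algebraMap] at hθ
      refine ⟨(IntermediateField.adjoin.powerBasis hIntg).lift θ (by rw [hPg]; exact hθ),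
        Finset.mem_univ _, ?_⟩
      rw [hg, ← IntermediateField.adjoin.powerBasis_gen hIntg, PowerBasis.lift_gen]
    · intro σ _
      rw [aeval_algHom_apply]
  rw [h2, mul_pow, ← pow_mul]
  congr 2
  rw [hdiv, mul_assoc, htower]


lemma wk_monic_finite (K : Type*) [Field K] [Finite K] (N : ℕ) :
    {h : K[X] | h.Monic ∧ h.natDegree = N}.Finite := by
  have h1 : Finite (degreeLT K (N + 1)) := Finite.of_equiv _ (degreeLTEquiv K (N + 1)).toEquiv.symm
  refine Set.Finite.subset (Set.toFinite ((degreeLT K (N + 1) : Submodule K K[X]) : Set K[X])) ?_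
  rintro h ⟨hm, hN⟩
  rw [SetLike.mem_coe, mem_degreeLT, degree_eq_natDegree hm.ne_zero, hN]
  exact_mod_cast Nat.lt_succ_self N

noncomputable def wkMn (K : Type*) [Field K] [Finite K] (N : ℕ) : Finset K[X] :=
  (wk_monic_finite K N).toFinset

lemma mem_wkMn {K : Type*} [Field K] [Finite K] {N : ℕ} {h : K[X]} :
    h ∈ wkMn K N ↔ h.Monic ∧ h.natDegree = N := by simp [wkMn]

open Classical in
noncomputable def wkIrr (K : Type*) [Field K] [Finite K] (N : ℕ) : Finset K[X] :=
  (wkMn K N).filter Irreducible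

open Classical in
lemma mem_wkIrr {K : Type*} [Field K] [Finite K] {N : ℕ} {h : K[X]} :
    h ∈ wkIrr K N ↔ (h.Monic ∧ h.natDegree = N) ∧ Irreducible h := by
  rw [wkIrr, Finset.mem_filter, mem_wkMn]

noncomputable def wkc {K : Type*} [Field K] [Finite K] (Y : K[X] →* ℂ) (N : ℕ) : ℂ :=
  ∑ h ∈ wkMn K N, Y h

noncomputable def wkS {K : Type*} [Field K] [Finite K] (Y : K[X] →* ℂ) (r : ℕ) : ℂ :=
  ∑ e ∈ r.divisors, ∑ P ∈ wkIrr K e, (e : ℂ) * Y P ^ (r / e)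

lemma wkc_zero {K : Type*} [Field K] [Finite K] (Y : K[X] →* ℂ) : wkc Y 0 = 1 := by
  have : wkMn K 0 = {1} := by
    ext h
    rw [mem_wkMn, Finset.mem_singleton]
    constructor
    · rintro ⟨hm, h0⟩; exact hm.natDegree_eq_zero.1 h0
    · rintro rfl; exact ⟨monic_one, natDegree_one⟩
  rw [wkc, this, Finset.sum_singleton, map_one]

open Classical in
lemma wk_count {K : Type*} [Field K] [Finite K] {N : ℕ} {h : K[X]} (hm : h.Monic)
    (hN : h.natDegree = N) :
    (N : ℕ) = ∑ e ∈ Finset.Icc 1 N, ∑ P ∈ wkIrr K e,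
      ((Finset.Icc 1 N).filter fun k => P ^ k ∣ h).card * e := by
  set n := UniqueFactorizationMonoid.normalizedFactors h with hn
  have h0 := hm.ne_zero
  have hprod : n.prod = h := by
    have := UniqueFactorizationMonoid.prod_normalizedFactors_eq h0
    rw [this, hm.normalize_eq_self]
  have hmon : ∀ P ∈ n, P.Monic := by
    intro P hP
    have h1 := UniqueFactorizationMonoid.irreducible_of_normalized_factor P hP
    have h2 := UniqueFactorizationMonoid.normalize_normalized_factor P hP
    rw [← h2]; exact monic_normalize h1.ne_zero
  have hdeg : N = (n.map natDegree).sum := by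
    rw [← natDegree_multiset_prod_of_monic n hmon, hprod, hN]
  have hcnt : ∀ P, P.Monic → Irreducible P → ∀ k, P ^ k ∣ h ↔ k ≤ n.count P := by
    intro P hPm hPi k
    rw [Multiset.le_count_iff_replicate_le, pow_dvd_iff_le_emultiplicity,
      UniqueFactorizationMonoid.le_emultiplicity_iff_replicate_le_normalizedFactors hPi h0,
      hPm.normalize_eq_self]
  have hcard : ∀ P, P.Monic → Irreducible P →
      ((Finset.Icc 1 N).filter fun k => P ^ k ∣ h).card = n.count P := by
    intro P hPm hPi
    have h1 : n.count P ≤ N := by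
      have h2 : P ^ n.count P ∣ h := (hcnt P hPm hPi _).2 le_rfl
      have h3 := natDegree_le_of_dvd h2 h0
      rw [hPm.natDegree_pow, hN] at h3
      have := hPi.natDegree_pos
      nlinarith
    have : ((Finset.Icc 1 N).filter fun k => P ^ k ∣ h) = Finset.Icc 1 (n.count P) := by
      ext k
      rw [Finset.mem_filter, hcnt P hPm hPi, Finset.mem_Icc, Finset.mem_Icc]
      omega
    rw [this]; simp
  have e1 : ∀ e ∈ Finset.Icc 1 N, ∑ P ∈ wkIrr K e,
      ((Finset.Icc 1 N).filter fun k => P ^ k ∣ h).card * e =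
      ∑ P ∈ n.toFinset.filter (fun P => P.natDegree = e), n.count P * P.natDegree := by
    intro e _
    symm
    have : n.toFinset.filter (fun P => P.natDegree = e) ⊆ wkIrr K e := by
      intro P hP
      rw [Finset.mem_filter, Multiset.mem_toFinset] at hP
      exact mem_wkIrr.2 ⟨⟨hmon P hP.1, hP.2⟩,
        UniqueFactorizationMonoid.irreducible_of_normalized_factor P hP.1⟩
    rw [← Finset.sum_subset this]
    · refine Finset.sum_congr rfl fun P hP => ?_
      obtain ⟨⟨h1, h2⟩, h3⟩ := mem_wkIrr.1 (this hP)
      rw [hcard P h1 h3, h2]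
    · intro P hP hP'
      obtain ⟨⟨h1, h2⟩, h3⟩ := mem_wkIrr.1 hP
      rw [hcard P h1 h3]
      have : P ∉ n := fun h4 => hP' (Finset.mem_filter.2 ⟨Multiset.mem_toFinset.2 h4, h2⟩)
      rw [Multiset.count_eq_zero_of_notMem this, zero_mul]
  rw [Finset.sum_congr rfl e1, Finset.sum_fiberwise_of_maps_to, ]
  · conv_lhs => rw [hdeg, Finset.sum_multiset_map_count]
    simp
  · intro P hP
    rw [Multiset.mem_toFinset] at hP
    have h1 := UniqueFactorizationMonoid.irreducible_of_normalized_factor P hP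
    rw [Finset.mem_Icc]
    refine ⟨h1.natDegree_pos, ?_⟩
    rw [← hN]
    exact natDegree_le_of_dvd (UniqueFactorizationMonoid.dvd_of_mem_normalizedFactors hP) h0

open Classical in
lemma wk_sum_dvd {K : Type*} [Field K] [Finite K] (Y : K[X] →* ℂ) (N k e : ℕ) (P : K[X])
    (hP : P ∈ wkIrr K e) :
    ∑ h ∈ (wkMn K N).filter (fun h => P ^ k ∣ h), Y h =
      if e * k ≤ N then Y P ^ k * wkc Y (N - e * k) else 0 := by
  obtain ⟨⟨h1, h2⟩, h3⟩ := mem_wkIrr.1 hP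
  have hd : (P ^ k).natDegree = e * k := by rw [h1.natDegree_pow, h2, mul_comm]
  split_ifs with hle
  · rw [wkc, Finset.mul_sum]
    symm
    refine Finset.sum_bij (fun h _ => P ^ k * h) ?_ ?_ ?_ ?_
    · intro h hh
      obtain ⟨h4, h5⟩ := mem_wkMn.1 hh
      refine Finset.mem_filter.2 ⟨mem_wkMn.2 ⟨(h1.pow k).mul h4, ?_⟩, dvd_mul_right _ _⟩
      rw [(h1.pow k).natDegree_mul h4, hd, h5]; omega
    · intro a _ b _ hab
      exact mul_left_cancel₀ (h1.pow k).ne_zero hab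
    · intro b hb
      obtain ⟨hb1, c, rfl⟩ := Finset.mem_filter.1 hb
      obtain ⟨h4, h5⟩ := mem_wkMn.1 hb1
      have hc : c.Monic := (h1.pow k).of_mul_monic_left h4
      refine ⟨c, mem_wkMn.2 ⟨hc, ?_⟩, rfl⟩
      rw [(h1.pow k).natDegree_mul hc, hd] at h5; omega
    · intro h _
      rw [map_mul, map_pow]
  · rw [Finset.sum_eq_zero]
    intro h hh
    obtain ⟨hb1, hb2⟩ := Finset.mem_filter.1 hh
    obtain ⟨h4, h5⟩ := mem_wkMn.1 hb1
    have := natDegree_le_of_dvd hb2 h4.ne_zero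
    omega

lemma wk_divisor_sum (N : ℕ) (g : ℕ → ℕ → ℂ) :
    ∑ e ∈ Finset.Icc 1 N, ∑ k ∈ Finset.Icc 1 N, (if e * k ≤ N then g e k else 0) =
      ∑ i ∈ Finset.Icc 1 N, ∑ e ∈ i.divisors, g e (i / e) := by
  have h1 : ∀ i ∈ Finset.Icc 1 N, ∑ e ∈ i.divisors, g e (i / e) =
      ∑ e ∈ Finset.Icc 1 N, ∑ k ∈ Finset.Icc 1 N, if e * k = i then g e k else 0 := by
    intro i hi
    rw [Finset.mem_Icc] at hi
    have hsub : i.divisors ⊆ Finset.Icc 1 N := by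
      intro e he
      have := Nat.pos_of_mem_divisors he
      have h2 := Nat.divisor_le he
      rw [Finset.mem_Icc]; omega
    rw [← Finset.sum_subset hsub]
    · refine Finset.sum_congr rfl fun e he => ?_
      have hpos := Nat.pos_of_mem_divisors he
      obtain ⟨⟨k, hk⟩, _⟩ := Nat.mem_divisors.1 he
      have hk' : i / e = k := by rw [hk]; exact Nat.mul_div_cancel_left _ hpos
      rw [hk', Finset.sum_eq_single k, if_pos hk.symm]
      · intro b _ hb
        rw [if_neg]
        intro h
        rw [hk] at h
        exact hb (Nat.eq_of_mul_eq_mul_left hpos h)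
      · intro h
        exfalso
        apply h
        rw [Finset.mem_Icc]
        have : k ≠ 0 := by rintro rfl; omega
        have : k ≤ i := by rw [hk]; exact Nat.le_mul_of_pos_left k hpos
        omega
    · intro e _ he
      refine Finset.sum_eq_zero fun k _ => ?_
      rw [if_neg]
      intro h
      exact he (Nat.mem_divisors.2 ⟨⟨k, h.symm⟩, by omega⟩)
  rw [Finset.sum_congr rfl h1]
  conv_rhs => rw [Finset.sum_comm]
  refine Finset.sum_congr rfl fun e he => ?_
  conv_rhs => rw [Finset.sum_comm]
  refine Finset.sum_congr rfl fun k hk => ?_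
  rw [Finset.mem_Icc] at he hk
  split_ifs with hle
  · rw [Finset.sum_ite_eq, if_pos]
    rw [Finset.mem_Icc]
    exact ⟨Nat.mul_pos (by omega) (by omega), hle⟩
  · rw [Finset.sum_ite_eq, if_neg]
    rw [Finset.mem_Icc]; omega

lemma wk_recurrence {K : Type*} [Field K] [Finite K] (Y : K[X] →* ℂ) (N : ℕ) :
    (N : ℂ) * wkc Y N = ∑ j ∈ Finset.range N, wkc Y j * wkS Y (N - j) := by
  classical
  have h1 : (N : ℂ) * wkc Y N = ∑ e ∈ Finset.Icc 1 N, ∑ k ∈ Finset.Icc 1 N,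
      if e * k ≤ N then wkc Y (N - e * k) * ∑ P ∈ wkIrr K e, (e : ℂ) * Y P ^ k else 0 := by
    have h2 : ∀ h ∈ wkMn K N, (N : ℂ) * Y h = ∑ e ∈ Finset.Icc 1 N, ∑ P ∈ wkIrr K e,
        ∑ k ∈ Finset.Icc 1 N, (e : ℂ) * (if P ^ k ∣ h then Y h else 0) := by
      intro h hh
      obtain ⟨h4, h5⟩ := mem_wkMn.1 hh
      conv_lhs => rw [wk_count h4 h5]
      push_cast
      rw [Finset.sum_mul]
      refine Finset.sum_congr rfl fun e _ => ?_
      rw [Finset.sum_mul]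
      refine Finset.sum_congr rfl fun P _ => ?_
      rw [← Finset.mul_sum, ← Finset.sum_filter, Finset.sum_const, nsmul_eq_mul]
      ring
    rw [wkc, Finset.mul_sum, Finset.sum_congr rfl h2, Finset.sum_comm]
    refine Finset.sum_congr rfl fun e _ => ?_
    rw [Finset.sum_comm]
    have h3 : ∀ P ∈ wkIrr K e, ∑ h ∈ wkMn K N, ∑ k ∈ Finset.Icc 1 N,
        (e : ℂ) * (if P ^ k ∣ h then Y h else 0) = ∑ k ∈ Finset.Icc 1 N,
        (e : ℂ) * (if e * k ≤ N then Y P ^ k * wkc Y (N - e * k) else 0) := by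
      intro P hP
      rw [Finset.sum_comm]
      refine Finset.sum_congr rfl fun k _ => ?_
      rw [← Finset.mul_sum, ← wk_sum_dvd Y N k e P hP, Finset.sum_filter]
    rw [Finset.sum_congr rfl h3, Finset.sum_comm]
    refine Finset.sum_congr rfl fun k _ => ?_
    split_ifs
    · rw [Finset.mul_sum]
      refine Finset.sum_congr rfl fun P _ => ?_
      ring
    · simp
  rw [h1, wk_divisor_sum N (fun e k => wkc Y (N - e * k) * ∑ P ∈ wkIrr K e, (e : ℂ) * Y P ^ k)]
  rw [← Finset.sum_range_reflect, Finset.range_eq_Ico]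
  refine Finset.sum_bij (fun i _ => i - 1) ?_ ?_ ?_ ?_
  · intro i hi; rw [Finset.mem_Icc] at hi; rw [Finset.mem_Ico]; omega
  · intro a ha b hb h; rw [Finset.mem_Icc] at ha hb; omega
  · intro b hb
    rw [Finset.mem_Ico] at hb
    exact ⟨b + 1, by rw [Finset.mem_Icc]; omega, by omega⟩
  · intro i hi
    rw [Finset.mem_Icc] at hi
    have e1 : N - 1 - (i - 1) = N - i := by omega
    have e2 : N - (N - i) = i := by omega
    rw [e1, e2, wkS, Finset.mul_sum]
    refine Finset.sum_congr rfl fun e he => ?_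
    rw [Nat.mul_div_cancel' (Nat.dvd_of_mem_divisors he)]

/-- vanishing of high coefficients -/
lemma wkc_vanish {K : Type*} [Field K] [Finite K] (Y : K[X] →* ℂ) {ρ u : K[X]} (hρ : ρ.Monic)
    (hY : ∀ h g, ρ ∣ h - g → Y h = Y g) (hu : IsCoprime u ρ) (hYu : Y u ≠ 1) {N : ℕ}
    (hN : ρ.natDegree ≤ N) : wkc Y N = 0 := by
  classical
  let T : K[X] → K[X] := fun h => h + (u * h %ₘ ρ - h %ₘ ρ)
  have hTY : ∀ h, Y (T h) = Y u * Y h := by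
    intro h
    rw [← map_mul]
    apply hY
    have h1 := modByMonic_add_div (u * h) ρ
    have h2 := modByMonic_add_div h ρ
    refine ⟨h /ₘ ρ - (u * h) /ₘ ρ, ?_⟩
    simp only [T]
    linear_combination h1 - h2
  have hTd : ∀ h, ρ ∣ T h - u * h := by
    intro h
    have h1 := modByMonic_add_div (u * h) ρ
    have h2 := modByMonic_add_div h ρ
    refine ⟨h /ₘ ρ - (u * h) /ₘ ρ, ?_⟩
    simp only [T]
    linear_combination h1 - h2
  have hTm : ∀ h ∈ wkMn K N, T h ∈ wkMn K N := by
    intro h hh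
    obtain ⟨h4, h5⟩ := mem_wkMn.1 hh
    have hlt : (u * h %ₘ ρ - h %ₘ ρ).degree < h.degree := by
      have h1 := degree_modByMonic_lt (u * h) hρ
      have h2 := degree_modByMonic_lt h hρ
      refine (degree_sub_le _ _).trans_lt ((max_lt h1 h2).trans_le ?_)
      rw [degree_eq_natDegree hρ.ne_zero, degree_eq_natDegree h4.ne_zero, h5]
      exact_mod_cast hN
    exact mem_wkMn.2 ⟨h4.add_of_left hlt, by rw [natDegree_add_eq_left_of_degree_lt hlt, h5]⟩
  have hTi : Set.InjOn T (wkMn K N) := by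
    intro a _ b _ hab
    have h1 : ρ ∣ u * (a - b) := by
      have := dvd_sub (hTd b) (hTd a)
      rw [hab] at this
      convert this using 1; ring
    have h2 : ρ ∣ a - b := hu.symm.dvd_of_dvd_mul_left h1
    have e1 : a %ₘ ρ = b %ₘ ρ := (modByMonic_eq_of_dvd_sub hρ h2)
    have e2 : u * a %ₘ ρ = u * b %ₘ ρ :=
      modByMonic_eq_of_dvd_sub hρ (by rw [← mul_sub]; exact h1)
    simp only [T, e1, e2] at hab
    exact add_right_cancel hab
  have hTim : (wkMn K N).image T = wkMn K N :=
    Finset.eq_of_subset_of_card_le (Finset.image_subset_iff.2 hTm)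
      (by rw [Finset.card_image_of_injOn hTi])
  have h1 : wkc Y N = Y u * wkc Y N := by
    conv_lhs => rw [wkc, ← hTim, Finset.sum_image hTi]
    rw [wkc, Finset.mul_sum]
    exact Finset.sum_congr rfl fun h _ => hTY h
  have h2 : (1 - Y u) * wkc Y N = 0 := by linear_combination h1
  exact (mul_eq_zero.1 h2).resolve_left (sub_ne_zero.2 (Ne.symm hYu))


lemma wk_card_minpoly {K L : Type*} [Field K] [Finite K] [Field L] [Algebra K L] [Fintype L]
    [DecidableEq K[X]] {P : K[X]} (hPm : P.Monic) (hPi : Irreducible P)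
    (hd : P.natDegree ∣ Module.finrank K L) :
    (Finset.univ.filter fun α : L => minpoly K α = P).card = P.natDegree := by
  classical
  haveI : Fintype K := Fintype.ofFinite K
  have hsplit : (P.map (algebraMap K L)).Splits := by
    have h1 := hPi.natDegree_dvd_iff_dvd_X_pow_card_pow_sub_X.1 hd
    have hc : Nat.card K ^ Module.finrank K L = Fintype.card L := by
      rw [Nat.card_eq_fintype_card, ← Module.card_eq_pow_finrank]
    rw [hc] at h1
    have h2 : ((X ^ Fintype.card L - X : K[X]).map (algebraMap K L)).Splits :=
      (FiniteField.isSplittingField_sub L K).splits'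
    refine h2.of_dvd ?_ (Polynomial.map_dvd _ h1)
    rw [Polynomial.map_ne_zero_iff (algebraMap K L).injective]
    exact FiniteField.X_pow_card_sub_X_ne_zero K Fintype.one_lt_card
  have hsep : P.Separable := PerfectField.separable_of_irreducible hPi
  rw [← card_rootSet_eq_natDegree hsep hsplit, ← Set.toFinset_card]
  congr 1
  ext α
  rw [Finset.mem_filter, Set.mem_toFinset, mem_rootSet]
  constructor
  · rintro ⟨_, h⟩
    refine ⟨hPm.ne_zero, ?_⟩
    rw [← h]; exact minpoly.aeval _ _
  · rintro ⟨_, h⟩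
    exact ⟨Finset.mem_univ _, (minpoly.eq_of_irreducible_of_monic hPi h hPm).symm⟩

lemma wkS_eq_sum {K L : Type*} [Field K] [Finite K] [Field L] [Algebra K L] [Fintype L]
    (Y : K[X] →* ℂ) :
    wkS Y (Module.finrank K L) =
      ∑ α : L, Y (minpoly K α) ^ (Module.finrank K L / (minpoly K α).natDegree) := by
  classical
  haveI : Module.Finite K L := Module.Finite.of_finite
  have hIntg : ∀ α : L, IsIntegral K α := fun α => Algebra.IsIntegral.isIntegral α
  have hr0 : Module.finrank K L ≠ 0 := Module.finrank_pos.ne'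
  rw [← Finset.sum_fiberwise_of_maps_to (t := (Module.finrank K L).divisors)
    (g := fun α : L => (minpoly K α).natDegree)
    (fun α _ => Nat.mem_divisors.2 ⟨minpoly.degree_dvd (hIntg α), hr0⟩), wkS]
  refine Finset.sum_congr rfl fun e he => ?_
  rw [← Finset.sum_fiberwise_of_maps_to (t := wkIrr K e) (g := fun α : L => minpoly K α)]
  · refine Finset.sum_congr rfl fun P hP => ?_
    obtain ⟨⟨h1, h2⟩, h3⟩ := mem_wkIrr.1 hP
    have h4 : ∀ α ∈ (Finset.univ.filter fun α : L => (minpoly K α).natDegree = e).filter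
        (fun α => minpoly K α = P),
        Y (minpoly K α) ^ (Module.finrank K L / (minpoly K α).natDegree) =
          Y P ^ (Module.finrank K L / e) := by
      intro α hα
      rw [(Finset.mem_filter.1 hα).2, h2]
    rw [Finset.sum_congr rfl h4, Finset.sum_const, nsmul_eq_mul]
    congr 2
    have h5 : (Finset.univ.filter fun α : L => (minpoly K α).natDegree = e).filter
        (fun α => minpoly K α = P) = Finset.univ.filter fun α : L => minpoly K α = P := by
      ext α
      simp only [Finset.mem_filter, Finset.mem_univ, true_and]
      constructor
      · exact fun h => h.2
      · exact fun h => ⟨by rw [h, h2], h⟩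
    rw [h5, wk_card_minpoly h1 h3 (by rw [h2]; exact Nat.dvd_of_mem_divisors he), h2]
  · intro α hα
    exact mem_wkIrr.2 ⟨⟨minpoly.monic (hIntg α), (Finset.mem_filter.1 hα).2⟩,
      minpoly.irreducible (hIntg α)⟩

/-- the Dirichlet-type character attached to `χ` and `f` -/
noncomputable def wkY {K : Type*} [Field K] (χ : MulChar K ℂ) {f : K[X]} (hf : f.Monic) :
    K[X] →* ℂ where
  toFun h := χ (wkRes f h)
  map_one' := by rw [wkRes_one hf, map_one]
  map_mul' a b := by rw [wkRes_mul hf, map_mul]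

lemma wkY_minpoly {K L : Type*} [Field K] [Finite K] [Field L] [Algebra K L] [Finite L]
    (χ : MulChar K ℂ) {f : K[X]} (hf : f.Monic) (α : L) :
    wkY χ hf (minpoly K α) ^ (Module.finrank K L / (minpoly K α).natDegree) =
      χ (-1) ^ (f.natDegree * Module.finrank K L) * χ (Algebra.norm K (aeval α f)) := by
  rw [← map_pow χ, ← map_mul, ← wkRes_minpoly hf α, map_pow]; rfl

lemma wkS_eq_norm_sum {K L : Type*} [Field K] [Finite K] [Field L] [Algebra K L] [Fintype L]
    (χ : MulChar K ℂ) {f : K[X]} (hf : f.Monic) :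
    wkS (wkY χ hf) (Module.finrank K L) = χ (-1) ^ (f.natDegree * Module.finrank K L) *
      ∑ α : L, χ (Algebra.norm K (aeval α f)) := by
  rw [wkS_eq_sum (L := L), Finset.mul_sum]
  exact Finset.sum_congr rfl fun α _ => wkY_minpoly χ hf α

lemma wk_norm_chi_neg_one {K : Type*} [Field K] (χ : MulChar K ℂ) : ‖χ (-1)‖ = 1 := by
  apply Complex.norm_eq_one_of_pow_eq_one (n := 2) _ two_ne_zero
  rw [← map_pow]; simp

/-- composite of a multiplicative character with the norm -/
noncomputable def wkNormChar {K : Type*} (L : Type*) [Field K] [Field L] [Algebra K L]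
    [FiniteDimensional K L] (χ : MulChar K ℂ) : MulChar L ℂ where
  toMonoidHom := χ.toMonoidHom.comp (Algebra.norm K)
  map_nonunit' a ha := by
    have : a = 0 := by by_contra h; exact ha (IsUnit.mk0 a h)
    subst this
    change χ (Algebra.norm K (0 : L)) = 0
    rw [Algebra.norm_zero, MulChar.map_zero]

lemma wkNormChar_apply {K : Type*} (L : Type*) [Field K] [Field L] [Algebra K L]
    [FiniteDimensional K L] (χ : MulChar K ℂ) (x : L) :
    wkNormChar L χ x = χ (Algebra.norm K x) := rfl

lemma wk_ext_bound {K L M : Type*} [Field K] [Fintype K] [Field M] [Algebra K M]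
    [Field L] [Algebra K L] [Fintype L] {ℓ k : ℕ}
    (hℓ : ℓ ∣ Fintype.card K - 1) {f : K[X]} (hf : f.Monic)
    (χ : MulChar K ℂ) (hχ : χ ^ ℓ = 1) (hχ1 : χ ≠ 1)
    (hmult : ∀ p : ℕ, p.Prime → p ∣ ℓ →
      ∃ θ : M, ¬ p ∣ (f.map (algebraMap K M)).rootMultiplicity θ)
    (hr : Module.finrank K L = 2 * Module.finrank K M * k)
    (hk : 4 * ℓ * (ℓ * f.natDegree + 2) ≤ k) (hk0 : k ≠ 0) (hM : Module.finrank K M ≠ 0) :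
    ‖∑ α : L, χ (Algebra.norm K (aeval α f))‖ ≤
      (4 * ℓ * (ℓ * f.natDegree + 2) + f.natDegree + 2) *
        (Fintype.card K : ℝ) ^ (Module.finrank K M * k) + f.natDegree := by
  haveI : Module.Finite K L := Module.Finite.of_finite
  have hL : Fintype.card L = (Fintype.card K ^ (Module.finrank K M * k)) ^ 2 := by
    rw [Module.card_eq_pow_finrank (K := K), hr, ← pow_mul]; congr 1; ring
  obtain ⟨φ⟩ : Nonempty (M →ₐ[K] L) := FiniteField.nonempty_algHom_of_finrank_dvd
    (by rw [hr]; exact ⟨2 * k, by ring⟩)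
  have hnd : (f.map (algebraMap K L)).natDegree = f.natDegree := natDegree_map _
  have hmap : f.map (algebraMap K L) = (f.map (algebraMap K M)).map (φ : M →+* L) := by
    rw [Polynomial.map_map]; congr 1; exact φ.comp_algebraMap.symm
  have key := wk_stepanov_char (L := L) (ℓ := ℓ) (a := Fintype.card K ^ (Module.finrank K M * k))
    ?_ hL (hf.map (algebraMap K L)) (wkNormChar L χ) ?_ ?_ ?_ ?_
  · rw [hnd] at key
    have e : ∑ α : L, wkNormChar L χ ((f.map (algebraMap K L)).eval α) =
        ∑ α : L, χ (Algebra.norm K (aeval α f)) := by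
      refine Finset.sum_congr rfl fun α _ => ?_
      rw [wkNormChar_apply, eval_map_algebraMap]
    rw [e] at key
    push_cast at key
    exact key
  · refine hℓ.trans ?_
    rw [Module.card_eq_pow_finrank (K := K) (V := L)]
    simpa using Nat.sub_dvd_pow_sub_pow (Fintype.card K) 1 (Module.finrank K L)
  · ext x
    have hℓ0 : ℓ ≠ 0 := by
      rintro rfl
      have : 1 < Fintype.card K := Fintype.one_lt_card
      rw [zero_dvd_iff] at hℓ; omega
    rw [MulChar.pow_apply' _ hℓ0, wkNormChar_apply, ← MulChar.pow_apply' _ hℓ0, hχ,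
      MulChar.one_apply_coe, MulChar.one_apply]
    exact (x.isUnit).map (Algebra.norm K)
  · intro h
    apply hχ1
    ext x
    obtain ⟨y, hy⟩ := FiniteField.unitsMap_norm_surjective K L x
    have h1 : wkNormChar L χ (y : L) = 1 := by rw [h, MulChar.one_apply_coe]
    rw [wkNormChar_apply] at h1
    rw [MulChar.one_apply_coe, ← hy]
    exact h1
  · intro p hp hpl
    obtain ⟨θ, hθ⟩ := hmult p hp hpl
    refine ⟨φ θ, ?_⟩
    rw [hmap]
    have := eq_rootMultiplicity_map (p := f.map (algebraMap K M)) (f := (φ : M →+* L))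
      (RingHom.injective _) θ
    rw [RingHom.coe_coe] at this
    rwa [← this]
  · rw [hnd]
    refine hk.trans ?_
    have h1 : k < Fintype.card K ^ k := Nat.lt_pow_self Fintype.one_lt_card
    refine h1.le.trans (Nat.pow_le_pow_right Fintype.card_pos ?_)
    exact Nat.le_mul_of_pos_left k (Nat.pos_of_ne_zero hM)

theorem wk_weil {K M : Type*} [Field K] [Fintype K] [Field M] [Algebra K M]
    [FiniteDimensional K M] {ℓ : ℕ}
    (hℓ : ℓ ∣ Fintype.card K - 1) {f ρ : K[X]} (hf : f.Monic) (hρ : ρ.Monic)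
    (hroots : ∀ θ : AlgebraicClosure K, aeval θ f = 0 ↔ aeval θ ρ = 0)
    (χ : MulChar K ℂ) (hχ : χ ^ ℓ = 1) (hχ1 : χ ≠ 1)
    (hmult : ∀ p : ℕ, p.Prime → p ∣ ℓ →
      ∃ θ : M, ¬ p ∣ (f.map (algebraMap K M)).rootMultiplicity θ) :
    ‖∑ α : K, χ (f.eval α)‖ ≤ (ρ.natDegree - 1 : ℕ) * √(Fintype.card K) := by
  classical
  set Q := Fintype.card K with hQ
  have hQ1 : 1 < Q := Fintype.one_lt_card
  set b := Module.finrank K M with hb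
  have hb0 : b ≠ 0 := Module.finrank_pos.ne'
  set c0 := 4 * ℓ * (ℓ * f.natDegree + 2) with hc0
  set m := f.natDegree with hm
  obtain ⟨p, hp⟩ := CharP.exists K
  haveI : Fact p.Prime := ⟨CharP.char_is_prime K p⟩
  have hQR : (1 : ℝ) < Q := by exact_mod_cast hQ1
  -- bound over extensions
  have hbd : ∀ k, c0 ≤ k → k ≠ 0 → ∃ (L : Type) (_ : Field L) (_ : Algebra K L) (_ : Fintype L),
      Module.finrank K L = 2 * b * k ∧ ‖∑ α : L, χ (Algebra.norm K (aeval α f))‖ ≤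
        ((c0 : ℝ) + 2 * m + 2) * (Q : ℝ) ^ (b * k) := by
    intro k hk hk0
    haveI : NeZero (2 * b * k) := ⟨by positivity⟩
    let L := FiniteField.Extension K p (2 * b * k)
    letI : Fintype L := Fintype.ofFinite L
    have hr : Module.finrank K L = 2 * b * k := FiniteField.finrank_extension K p _
    refine ⟨L, inferInstance, inferInstance, inferInstance, hr, ?_⟩
    refine (wk_ext_bound (L := L) (M := M) hℓ hf χ hχ hχ1 hmult hr hk hk0 hb0).trans ?_
    have h1 : (1 : ℝ) ≤ (Q : ℝ) ^ (b * k) := one_le_pow₀ hQR.le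
    rw [← hQ, ← hm, ← hb, hc0]
    push_cast
    have h2 : (0 : ℝ) ≤ m := by positivity
    nlinarith
  set Y := wkY χ hf with hY
  -- existence of a nontrivial value
  obtain ⟨u, hu0, hu1⟩ : ∃ u, Y u ≠ 0 ∧ Y u ≠ 1 := by
    by_contra hcon
    push Not at hcon
    obtain ⟨k, hkc, hkQ⟩ : ∃ k : ℕ, max c0 1 ≤ k ∧ ((c0 : ℝ) + 2 * m + 2) + m < (Q : ℝ) ^ k :=
      ((Filter.eventually_ge_atTop _).and
        ((tendsto_pow_atTop_atTop_of_one_lt hQR).eventually_gt_atTop _)).exists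
    obtain ⟨L, _, _, _, hr, hL⟩ := hbd k (le_trans (le_max_left _ _) hkc)
      (by have := (le_max_right c0 1).trans hkc; omega)
    have h1 : ‖∑ α : L, χ (Algebra.norm K (aeval α f))‖ = ‖wkS Y (Module.finrank K L)‖ := by
      rw [hY, wkS_eq_norm_sum (L := L), norm_mul, norm_pow, wk_norm_chi_neg_one, one_pow, one_mul]
    haveI : Module.Finite K L := Module.Finite.of_finite
    have hcardL : Fintype.card L = Q ^ (2 * b * k) := by
      rw [Module.card_eq_pow_finrank (K := K), hr]
    have h2 : wkS Y (Module.finrank K L) =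
        ((Finset.univ.filter fun α : L => aeval α f ≠ 0).card : ℂ) := by
      rw [wkS_eq_sum (L := L), Finset.card_filter]
      push_cast
      refine Finset.sum_congr rfl fun α _ => ?_
      have h3 := wkY_minpoly χ hf α
      have hexp : Module.finrank K L / (minpoly K α).natDegree ≠ 0 := by
        have hIntg : IsIntegral K α := Algebra.IsIntegral.isIntegral α
        have := Nat.div_pos (Nat.le_of_dvd Module.finrank_pos (minpoly.degree_dvd hIntg))
          (minpoly.natDegree_pos hIntg)
        omega
      split_ifs with h0
      · have h5 : Y (minpoly K α) ≠ 0 := by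
          intro h6
          rw [← hY, h6, zero_pow hexp] at h3
          have h7 : χ (Algebra.norm K (aeval α f)) ≠ 0 := by
            have : IsUnit (Algebra.norm K (aeval α f)) := (IsUnit.mk0 _ h0).map (Algebra.norm K)
            exact (this.map χ).ne_zero
          have h8 : χ (-1) ≠ 0 := by
            rw [← norm_ne_zero_iff, wk_norm_chi_neg_one]; exact one_ne_zero
          exact mul_ne_zero (pow_ne_zero _ h8) h7 h3.symm
        rw [hcon _ h5, one_pow]
      · rw [not_not] at h0
        rw [h3, h0, Algebra.norm_zero, MulChar.map_zero, mul_zero]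
    have h3 : Fintype.card L ≤ (Finset.univ.filter fun α : L => aeval α f ≠ 0).card + m := by
      have h4 := Finset.card_filter_add_card_filter_not (s := (Finset.univ : Finset L))
        (fun α : L => aeval α f ≠ 0)
      rw [Finset.card_univ] at h4
      rw [← h4]
      refine Nat.add_le_add_left ?_ _
      have h5 : (Finset.univ.filter fun α : L => ¬ aeval α f ≠ 0) ⊆
          (f.map (algebraMap K L)).roots.toFinset := by
        intro α hα
        have := (Finset.mem_filter.1 hα).2
        rw [not_not] at this
        rw [Multiset.mem_toFinset, mem_roots (hf.map _).ne_zero, IsRoot, eval_map_algebraMap]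
        exact this
      refine (Finset.card_le_card h5).trans ((Multiset.toFinset_card_le _).trans
        ((card_roots' _).trans ?_))
      rw [natDegree_map]
    rw [h1, h2, Complex.norm_natCast] at hL
    have h4 : ((Q : ℝ) ^ (b * k)) ^ 2 ≤ ((c0 : ℝ) + 2 * m + 2) * (Q : ℝ) ^ (b * k) + m := by
      have h5 : ((Fintype.card L : ℕ) : ℝ) ≤
          (((Finset.univ.filter fun α : L => aeval α f ≠ 0).card + m : ℕ) : ℝ) := by
        exact_mod_cast h3
      rw [hcardL] at h5
      push_cast at h5
      have e : ((Q : ℝ) ^ (b * k)) ^ 2 = (Q : ℝ) ^ (2 * b * k) := by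
        rw [← pow_mul]; congr 1; ring
      rw [e]
      linarith
    have h5 : (Q : ℝ) ^ k ≤ (Q : ℝ) ^ (b * k) :=
      pow_le_pow_right₀ hQR.le (Nat.le_mul_of_pos_left k (Nat.pos_of_ne_zero hb0))
    have h6 : (1 : ℝ) ≤ (Q : ℝ) ^ (b * k) := one_le_pow₀ hQR.le
    have h7 : (0 : ℝ) ≤ m := by positivity
    nlinarith
  have hcop : IsCoprime u ρ := wkRes_coprime hf (fun θ => (hroots θ).2) (by
    intro h
    apply hu0
    change χ (wkRes f u) = 0
    rw [h, MulChar.map_zero])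
  have hvan : ∀ N, ρ.natDegree - 1 < N → wkc Y N = 0 := fun N hN =>
    wkc_vanish Y hρ (fun h g hd => by
      change χ (wkRes f h) = χ (wkRes f g)
      rw [wkRes_congr hf (fun θ => (hroots θ).1) hd]) hcop hu1 (by omega)
  obtain ⟨ω, hω⟩ := wk_newton (ρ.natDegree - 1) (wkc Y) (wkS Y) (wkc_zero Y) hvan
    (wk_recurrence Y)
  have hsq : √(Q : ℝ) ^ 2 = Q := Real.sq_sqrt (by positivity)
  have hωb : ∀ i, ‖ω i‖ ≤ √(Q : ℝ) := by
    intro i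
    refine wk_psum_bound_mul ω ((c0 : ℝ) + 2 * m + 2) _ (by positivity) (2 * b) (max c0 1)
      (by positivity) (fun k hk => ?_) i
    have hk0 : k ≠ 0 := by have := (le_max_right c0 1).trans hk; omega
    obtain ⟨L, _, _, _, hr, hL⟩ := hbd k (le_trans (le_max_left _ _) hk) hk0
    have h1 := hω (2 * b * k) (Nat.one_le_iff_ne_zero.2 (by positivity))
    have h2 : ‖∑ i, ω i ^ (2 * b * k)‖ = ‖wkS Y (2 * b * k)‖ := by rw [h1, norm_neg]
    rw [h2, ← hr, hY, wkS_eq_norm_sum (L := L), norm_mul, norm_pow, wk_norm_chi_neg_one, one_pow,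
      one_mul, hr, mul_assoc 2 b k, pow_mul, hsq]
    exact hL
  have h1 := hω 1 le_rfl
  have h2 := wkS_eq_norm_sum (L := K) χ hf
  rw [Module.finrank_self] at h2
  have h3 : ∑ α : K, χ (Algebra.norm K (aeval α f)) = ∑ α : K, χ (f.eval α) := by
    refine Finset.sum_congr rfl fun α _ => ?_
    rw [Algebra.norm_self]
    simp
  rw [h3] at h2
  have h4 := congrArg norm h2
  rw [norm_mul, norm_pow, wk_norm_chi_neg_one, one_pow, one_mul, ← hY, h1, norm_neg] at h4
  rw [← h4]
  refine (norm_sum_le _ _).trans ?_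
  refine (Finset.sum_le_sum fun i _ => by simpa using hωb i).trans ?_
  simp


lemma wk_rootMultiplicity_prod {R ι : Type*} [CommRing R] [IsDomain R] (s : Finset ι)
    (u : ι → R[X]) (hu : ∀ i, u i ≠ 0) (x : R) :
    rootMultiplicity x (∏ i ∈ s, u i) = ∑ i ∈ s, rootMultiplicity x (u i) := by
  classical
  induction s using Finset.induction_on with
  | empty => simp
  | insert a s ha ih =>
    rw [Finset.prod_insert ha, Finset.sum_insert ha, rootMultiplicity_mul, ih]
    exact mul_ne_zero (hu a) (Finset.prod_ne_zero_iff.2 fun i _ => hu i)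

lemma wk_char_pow_eq_one {E : Type*} [Field E] [Fintype E] {ℓ : ℕ} (hℓ : ℓ ≠ 0) (χ : MulChar E ℂ)
    (hχ : orderOf χ = ℓ) {y : E} (hy : y ≠ 0) : χ y ^ ℓ = 1 := by
  rw [← MulChar.pow_apply' _ hℓ, ← hχ, pow_orderOf_eq_one]
  exact MulChar.one_apply (IsUnit.mk0 y hy)

lemma wk_char_eq_one {E : Type*} [Field E] [Fintype E] {ℓ : ℕ} (hℓ : ℓ ≠ 0) (χ : MulChar E ℂ)
    (hχ : orderOf χ = ℓ) {y : E} (hy : y ≠ 0) (h1 : χ y = 1) : ∃ γ : Eˣ, (γ : E) ^ ℓ = y := by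
  obtain ⟨γ, hγ⟩ := IsCyclic.exists_generator (α := Eˣ)
  have hpowγ : ∀ x : Eˣ, ∃ k : ℕ, γ ^ k = x := fun x => by
    have := hγ x
    rwa [← mem_powers_iff_mem_zpowers] at this
  obtain ⟨k, hk⟩ := hpowγ (Units.mk0 y hy)
  have hk' : (γ : E) ^ k = y := by
    rw [← Units.val_pow_eq_pow_val, hk, Units.val_mk0]
  have h2 : ℓ ∣ k := by
    rw [← hχ]
    by_cases hk0 : k = 0
    · rw [hk0]; exact dvd_zero _
    apply orderOf_dvd_of_pow_eq_one
    ext x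
    obtain ⟨j, rfl⟩ := hpowγ x
    rw [MulChar.one_apply_coe, MulChar.pow_apply' _ hk0, Units.val_pow_eq_pow_val, map_pow,
      ← pow_mul, mul_comm, pow_mul, ← map_pow, hk', h1, one_pow]
  obtain ⟨j, rfl⟩ := h2
  refine ⟨γ ^ j, ?_⟩
  rw [Units.val_pow_eq_pow_val, ← pow_mul, mul_comm, hk']

/-- Weil bound for products of distinct monic irreducibles defined over a subfield. -/
lemma wk_weil_prod {F E ι : Type*} [Field F] [Finite F] [Field E] [Fintype E] [Algebra F E]
    [Fintype ι] {ℓ D : ℕ} (hℓ1 : 1 < ℓ) (hℓ : ℓ ∣ Fintype.card E - 1) (g : ι → F[X])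
    (hg : Function.Injective g) (hgm : ∀ i, (g i).Monic) (hgi : ∀ i, Irreducible (g i))
    (hD : ∑ i, (g i).natDegree ≤ D) (χ : MulChar E ℂ) (hχ : orderOf χ = ℓ)
    (e : ι → ℕ) (he : ∀ i, e i < ℓ) (he0 : ∃ i, e i ≠ 0) :
    ‖∑ α : E, ∏ i, χ (aeval α (g i)) ^ e i‖ ≤ (D - 1 : ℕ) * √(Fintype.card E) := by
  classical
  obtain ⟨i0, hi0⟩ := he0
  set t := Nat.gcd ℓ (Finset.univ.gcd e) with ht
  have htℓ : t ∣ ℓ := Nat.gcd_dvd_left _ _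
  have hte : ∀ i, t ∣ e i := fun i =>
    (Nat.gcd_dvd_right _ _).trans (Finset.gcd_dvd (Finset.mem_univ i))
  have ht0 : t ≠ 0 := by
    intro h
    rw [h, zero_dvd_iff] at htℓ; omega
  have htlt : t < ℓ := (Nat.le_of_dvd (Nat.pos_of_ne_zero hi0) (hte i0)).trans_lt (he i0)
  obtain ⟨ℓ0, hℓ0⟩ := htℓ
  choose e' he' using hte
  set ψ := χ ^ t with hψ
  have hψℓ : ψ ^ ℓ0 = 1 := by rw [hψ, ← pow_mul, ← hℓ0, ← hχ, pow_orderOf_eq_one]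
  have hψ1 : ψ ≠ 1 := by
    intro h
    have := orderOf_dvd_of_pow_eq_one h
    rw [hχ] at this
    have := Nat.le_of_dvd (Nat.pos_of_ne_zero ht0) this
    omega
  set φ := algebraMap F E with hφ
  set f : E[X] := ∏ i, ((g i).map φ) ^ e' i with hf
  set T := Finset.univ.filter fun i => e' i ≠ 0 with hT
  set ρ : E[X] := ∏ i ∈ T, (g i).map φ with hρ
  have hfm : f.Monic := monic_prod_of_monic _ _ fun i _ => ((hgm i).map φ).pow _
  have hρm : ρ.Monic := monic_prod_of_monic _ _ fun i _ => (hgm i).map φ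
  have hρd : ρ.natDegree ≤ D := by
    rw [hρ, natDegree_prod_of_monic _ _ fun i _ => (hgm i).map φ]
    refine le_trans ?_ hD
    simp only [natDegree_map]
    exact Finset.sum_le_sum_of_subset (Finset.subset_univ _)
  have hroots : ∀ θ : AlgebraicClosure E, aeval θ f = 0 ↔ aeval θ ρ = 0 := by
    intro θ
    rw [hf, hρ, map_prod, map_prod, Finset.prod_eq_zero_iff, Finset.prod_eq_zero_iff]
    constructor
    · rintro ⟨i, _, h⟩
      rw [map_pow] at h
      refine ⟨i, Finset.mem_filter.2 ⟨Finset.mem_univ _, ?_⟩, eq_zero_of_pow_eq_zero h⟩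
      intro h0
      rw [h0, pow_zero] at h
      exact one_ne_zero h
    · rintro ⟨i, hi, h⟩
      refine ⟨i, Finset.mem_univ _, ?_⟩
      rw [map_pow, h, zero_pow (Finset.mem_filter.1 hi).2]
  have hcop : ∀ i j, i ≠ j → IsCoprime (g i) (g j) := by
    intro i j hij
    rw [(hgi i).coprime_iff_not_dvd]
    intro h
    exact hij (hg (eq_of_monic_of_associated (hgm i) (hgm j)
      ((hgi i).associated_of_dvd (hgi j) h)))
  let M := SplittingField (∏ i, (g i).map φ)
  have hmult : ∀ p : ℕ, p.Prime → p ∣ ℓ0 →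
      ∃ θ : M, ¬ p ∣ (f.map (algebraMap E M)).rootMultiplicity θ := by
    intro p hp hpl
    obtain ⟨i, hi⟩ : ∃ i, ¬ p ∣ e' i := by
      by_contra hcon
      push Not at hcon
      have h1 : t * p ∣ t := by
        conv_rhs => rw [ht]
        refine Nat.dvd_gcd (hℓ0 ▸ mul_dvd_mul_left t hpl) (Finset.dvd_gcd fun i _ => ?_)
        rw [he' i]
        exact mul_dvd_mul_left t (hcon i)
      have h2 := Nat.le_of_dvd (Nat.pos_of_ne_zero ht0) h1
      have h3 := hp.two_le
      have h4 := Nat.pos_of_ne_zero ht0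
      nlinarith
    set τ : F →+* M := (algebraMap E M).comp φ with hτ
    have hGi : ∀ j, ((g j).map φ).map (algebraMap E M) = (g j).map τ := fun j => by
      rw [Polynomial.map_map]
    have hsplit : ((g i).map τ).Splits := by
      have h1 := SplittingField.splits (∏ i, (g i).map φ)
      refine h1.of_dvd ?_ ?_
      · exact ((monic_prod_of_monic _ _ fun i _ => (hgm i).map φ).map _).ne_zero
      · rw [← hGi]
        exact Polynomial.map_dvd _ (Finset.dvd_prod_of_mem _ (Finset.mem_univ i))
    obtain ⟨θ, hθ⟩ := hsplit.exists_eval_eq_zero (by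
      rw [degree_map]
      exact (degree_pos_of_irreducible (hgi i)).ne')
    refine ⟨θ, ?_⟩
    have hne : ∀ j, (g j).map τ ≠ 0 := fun j => ((hgm j).map τ).ne_zero
    have h1 : f.map (algebraMap E M) = ∏ j, ((g j).map τ) ^ e' j := by
      rw [hf, Polynomial.map_prod]
      exact Finset.prod_congr rfl fun j _ => by rw [Polynomial.map_pow, hGi]
    rw [h1, wk_rootMultiplicity_prod _ _ fun j => pow_ne_zero _ (hne j)]
    have h2 : ∀ j, rootMultiplicity θ (((g j).map τ) ^ e' j) = if j = i then e' i else 0 := by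
      intro j
      rw [wk_rootMultiplicity_pow (hne j)]
      split_ifs with hji
      · subst hji
        have hsep : ((g j).map τ).Separable :=
          Separable.map (PerfectField.separable_of_irreducible (hgi j))
        have h3 : rootMultiplicity θ ((g j).map τ) = 1 := by
          refine le_antisymm (rootMultiplicity_le_one_of_separable hsep θ) ?_
          exact (rootMultiplicity_pos (hne j)).2 hθ
        rw [h3, mul_one]
      · have h3 : rootMultiplicity θ ((g j).map τ) = 0 := by
          rw [rootMultiplicity_eq_zero_iff]
          intro h4
          exfalso
          obtain ⟨a, b, hab⟩ := hcop j i hji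
          have h5 := congrArg (fun P => (P.map τ).eval θ) hab
          simp only [Polynomial.map_add, Polynomial.map_mul, eval_add, eval_mul] at h5
          rw [h4.eq_zero, hθ] at h5
          simp at h5
        rw [h3, mul_zero]
    simp only [h2, Finset.sum_ite_eq', Finset.mem_univ, if_true]
    exact hi
  have hdvdE : ℓ0 ∣ Fintype.card E - 1 := (Dvd.intro_left t hℓ0.symm).trans hℓ
  have key := wk_weil (K := E) (M := M) hdvdE hfm hρm hroots ψ hψℓ hψ1 hmult
  have hsum : ∑ α : E, ψ (f.eval α) = ∑ α : E, ∏ i, χ (aeval α (g i)) ^ e i := by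
    refine Finset.sum_congr rfl fun α _ => ?_
    rw [hf, eval_prod, map_prod]
    refine Finset.prod_congr rfl fun i _ => ?_
    rw [eval_pow, map_pow, hψ, MulChar.pow_apply' _ ht0, ← pow_mul, ← he' i, hφ,
      eval_map_algebraMap]
  rw [hsum] at key
  refine key.trans (mul_le_mul_of_nonneg_right ?_ (Real.sqrt_nonneg _))
  exact_mod_cast Nat.sub_le_sub_right hρd 1

lemma wk_geom_le (q s : ℕ) (hq : 2 ≤ q) : ∑ t ∈ Finset.range s, q ^ (t + 1) ≤ 2 * q ^ s := by
  induction s with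
  | zero => simp
  | succ s ih =>
    rw [Finset.sum_range_succ]
    have : 2 * q ^ s ≤ q ^ (s + 1) := by rw [pow_succ']; exact Nat.mul_le_mul_right _ hq
    omega

lemma wk_low_count {F E : Type*} [Field F] [Fintype F] [Field E] [Fintype E] [Algebra F E]
    {n : ℕ} (hn : Module.finrank F E = n) :
    (Finset.univ.filter fun α : E => (minpoly F α).natDegree ≠ n).card ≤
      2 * Fintype.card F ^ (n / 2) := by
  classical
  haveI : Module.Finite F E := Module.Finite.of_finite
  set q := Fintype.card F with hq
  have hq1 : 1 < q := Fintype.one_lt_card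
  refine le_trans ?_ (wk_geom_le q (n / 2) hq1)
  have hsub : (Finset.univ.filter fun α : E => (minpoly F α).natDegree ≠ n) ⊆
      (Finset.range (n / 2)).biUnion fun t => (X ^ q ^ (t + 1) - X : E[X]).roots.toFinset := by
    intro α hα
    have hα' := (Finset.mem_filter.1 hα).2
    have hIntg : IsIntegral F α := Algebra.IsIntegral.isIntegral α
    have hpos := minpoly.natDegree_pos hIntg
    have hdvd := minpoly.degree_dvd hIntg
    rw [hn] at hdvd
    have hn0 : 0 < n := hn ▸ Module.finrank_pos
    obtain ⟨c, hc⟩ := hdvd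
    have hle : (minpoly F α).natDegree ≤ n / 2 := by
      rw [Nat.le_div_iff_mul_le two_pos]
      have h1 : c ≠ 0 := by rintro rfl; omega
      have h2 : c ≠ 1 := by rintro rfl; exact hα' (by rw [hc, mul_one])
      have : 2 ≤ c := by omega
      calc _ ≤ (minpoly F α).natDegree * c := Nat.mul_le_mul_left _ this
        _ = n := hc.symm
    refine Finset.mem_biUnion.2 ⟨(minpoly F α).natDegree - 1, Finset.mem_range.2 (by omega), ?_⟩
    rw [Nat.sub_add_cancel hpos, Multiset.mem_toFinset, mem_roots
      (FiniteField.X_pow_card_pow_sub_X_ne_zero E hpos.ne' hq1)]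
    obtain ⟨w, hw⟩ := (minpoly.irreducible hIntg).natDegree_dvd_iff_dvd_X_pow_card_pow_sub_X.1
      (dvd_refl (minpoly F α).natDegree)
    have h3 := congrArg (aeval α) hw
    rw [map_mul, minpoly.aeval, zero_mul, Nat.card_eq_fintype_card] at h3
    simpa using h3
  refine (Finset.card_le_card hsub).trans (Finset.card_biUnion_le.trans
    (Finset.sum_le_sum fun t _ => ?_))
  refine (Multiset.toFinset_card_le _).trans ((card_roots' _).trans ?_)
  rw [FiniteField.X_pow_card_pow_sub_X_natDegree_eq E (Nat.succ_ne_zero t) hq1]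


lemma wk_irred_finite (F : Type*) [Field F] [Finite F] {d : ℕ} (hd : 1 ≤ d) :
    (irredDvdSet F d).Finite := by
  have h1 : (⋃ e ∈ Finset.range (d + 1), {h : F[X] | h.Monic ∧ h.natDegree = e}).Finite :=
    Set.Finite.biUnion (Finset.finite_toSet _) (fun e _ => wk_monic_finite F e)
  refine h1.subset ?_
  rintro g ⟨hm, hi, hdv⟩
  simp only [Set.mem_iUnion]
  have := Nat.le_of_dvd (by omega) hdv
  exact ⟨g.natDegree, Finset.mem_range.2 (by omega), hm, rfl⟩

lemma wk_irred_sum {F : Type*} [Field F] [Fintype F] {d : ℕ} (hd : 1 ≤ d) (I : Finset F[X])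
    (hI : ∀ g ∈ I, g ∈ irredDvdSet F d) :
    ∑ g ∈ I, g.natDegree ≤ Fintype.card F ^ d := by
  have hq : 1 < Fintype.card F := Fintype.one_lt_card
  have hdv : ∏ g ∈ I, g ∣ (X ^ Fintype.card F ^ d - X : F[X]) := by
    refine Finset.prod_dvd_of_coprime ?_ ?_
    · intro a ha b hb hab
      obtain ⟨ham, hai, -⟩ := hI a ha
      obtain ⟨hbm, hbi, -⟩ := hI b hb
      refine (Irreducible.coprime_iff_not_dvd hai).2 fun h => hab ?_
      exact eq_of_monic_of_associated ham hbm (hai.associated_of_dvd hbi h)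
    · intro g hg
      obtain ⟨hgm, hgi, hgd⟩ := hI g hg
      have := (Irreducible.natDegree_dvd_iff_dvd_X_pow_card_pow_sub_X (n := d) hgi).1 hgd
      rwa [Nat.card_eq_fintype_card] at this
  have hne := FiniteField.X_pow_card_pow_sub_X_ne_zero F (by omega : d ≠ 0) hq
  have h := natDegree_le_of_dvd hdv hne
  rwa [FiniteField.X_pow_card_pow_sub_X_natDegree_eq F (by omega : d ≠ 0) hq,
    natDegree_prod_of_monic _ _ (fun g hg => (hI g hg).1)] at h

lemma wk_cond {q n d ℓ k : ℕ} (hq : 1 < q) (hℓ : 1 < ℓ)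
    (hcond : 2 * (d : ℝ) + 2 * ((k : ℝ) + 1) * (Real.log ℓ / Real.log q) ≤ (n : ℝ)) :
    ((q : ℝ) ^ d * (ℓ : ℝ) ^ (k + 1)) ≤ √((q : ℝ) ^ n) := by
  have hq' : (1 : ℝ) < q := by exact_mod_cast hq
  have hℓ' : (1 : ℝ) < ℓ := by exact_mod_cast hℓ
  have hlq := Real.log_pos hq'
  have hq0 : (0 : ℝ) < q := by linarith
  have hl0 : (0 : ℝ) < ℓ := by linarith
  refine Real.le_sqrt_of_sq_le ?_
  rw [← Real.log_le_log_iff (by positivity) (by positivity), Real.log_pow, Real.log_pow,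
    Real.log_mul (by positivity) (by positivity), Real.log_pow, Real.log_pow]
  have h := mul_le_mul_of_nonneg_right hcond hlq.le
  have e : (2 * (d : ℝ) + 2 * ((k : ℝ) + 1) * (Real.log ℓ / Real.log q)) * Real.log q
      = 2 * (d * Real.log q + ((k : ℝ) + 1) * Real.log ℓ) := by
    field_simp
  rw [e] at h
  push_cast
  exact h

lemma wk_geom_zero {z : ℂ} {ℓ : ℕ} (h1 : z ≠ 1) (hz : z ^ ℓ = 1) :
    ∑ j ∈ Finset.range ℓ, z ^ j = 0 := by
  rw [geom_sum_eq h1, hz, sub_self, zero_div]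

lemma wk_char_norm_le {E : Type*} [Field E] [Fintype E] {ℓ : ℕ} (hℓ : ℓ ≠ 0) (χ : MulChar E ℂ)
    (hχ : orderOf χ = ℓ) (y : E) : ‖χ y‖ ≤ 1 := by
  by_cases hy : y = 0
  · subst hy; rw [MulChar.map_zero]; simp
  · exact (Complex.norm_eq_one_of_pow_eq_one (wk_char_pow_eq_one hℓ χ hχ hy) hℓ).le

lemma wk_final_count {F E ι : Type*} [Field F] [Fintype F] [Field E] [Fintype E] [Algebra F E]
    [Fintype ι] [DecidableEq ι] {n ℓ D : ℕ} (hn : Module.finrank F E = n) (hℓ1 : 1 < ℓ)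
    (hℓ : ℓ ∣ Fintype.card E - 1)
    (g : ι → F[X]) (hg : Function.Injective g) (hgm : ∀ i, (g i).Monic)
    (hgi : ∀ i, Irreducible (g i)) (hgn : ∀ i, (g i).natDegree < n)
    (hD : ∑ i, (g i).natDegree ≤ D)
    (hno : ∀ α : E, (minpoly F α).natDegree = n →
      ∃ i, ¬ ∃ γ : Eˣ, (γ : E) ^ ℓ = aeval α (g i)) :
    (Fintype.card E : ℝ) ≤ (2 * Fintype.card F ^ (n / 2) : ℕ) * (ℓ : ℝ) ^ Fintype.card ι
      + ((ℓ : ℝ) ^ Fintype.card ι - 1) * ((D - 1 : ℕ) * √(Fintype.card E)) := by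
  classical
  have hℓ0 : ℓ ≠ 0 := by omega
  haveI : NeZero ℓ := ⟨hℓ0⟩
  obtain ⟨χ, hχ⟩ := MulChar.exists_mulChar_orderOf E hℓ (Complex.isPrimitiveRoot_exp ℓ hℓ0)
  set P := Fintype.piFinset (fun _ : ι => Finset.range ℓ) with hP
  have hPc : P.card = ℓ ^ Fintype.card ι := by simp [hP]
  have key : ∑ e ∈ P, ∑ α : E, ∏ i, χ (aeval α (g i)) ^ e i
      = ∑ α : E, ∏ i, ∑ j ∈ Finset.range ℓ, χ (aeval α (g i)) ^ j := by
    rw [Finset.sum_comm]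
    refine Finset.sum_congr rfl fun α _ => ?_
    rw [Finset.prod_univ_sum]
  have h0P : (0 : ι → ℕ) ∈ P := by
    simp [hP, Fintype.mem_piFinset]; omega
  rw [← Finset.add_sum_erase _ _ h0P] at key
  have hz : ∑ α : E, ∏ i, χ (aeval α (g i)) ^ (0 : ι → ℕ) i = (Fintype.card E : ℂ) := by simp
  rw [hz] at key
  have hrest : ‖∑ e ∈ P.erase 0, ∑ α : E, ∏ i, χ (aeval α (g i)) ^ e i‖
      ≤ ((ℓ : ℝ) ^ Fintype.card ι - 1) * ((D - 1 : ℕ) * √(Fintype.card E)) := by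
    refine (norm_sum_le_of_le _ (n := fun _ => ((D - 1 : ℕ) * √(Fintype.card E) : ℝ)) ?_).trans ?_
    · intro e he
      rw [Finset.mem_erase, hP, Fintype.mem_piFinset] at he
      refine wk_weil_prod hℓ1 hℓ g hg hgm hgi hD χ hχ e
        (fun i => Finset.mem_range.1 (he.2 i)) ?_
      by_contra hcon
      push Not at hcon
      exact he.1 (funext hcon)
    · rw [Finset.sum_const, Finset.card_erase_of_mem h0P, hPc, nsmul_eq_mul]
      refine le_of_eq ?_
      rw [Nat.cast_sub (Nat.one_le_pow _ _ (by omega))]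
      push_cast
      rfl
  have hright : ‖∑ α : E, ∏ i, ∑ j ∈ Finset.range ℓ, χ (aeval α (g i)) ^ j‖
      ≤ (2 * Fintype.card F ^ (n / 2) : ℕ) * (ℓ : ℝ) ^ Fintype.card ι := by
    have hsub : ∑ α : E, ∏ i, ∑ j ∈ Finset.range ℓ, χ (aeval α (g i)) ^ j
        = ∑ α ∈ Finset.univ.filter (fun α : E => (minpoly F α).natDegree ≠ n),
          ∏ i, ∑ j ∈ Finset.range ℓ, χ (aeval α (g i)) ^ j := by
      symm
      refine Finset.sum_subset (Finset.filter_subset _ _) ?_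
      intro α _ hα
      simp only [Finset.mem_filter, Finset.mem_univ, true_and, not_not] at hα
      obtain ⟨i, hi⟩ := hno α hα
      refine Finset.prod_eq_zero (Finset.mem_univ i) ?_
      have hne : aeval α (g i) ≠ 0 := by
        intro h
        have h2 := natDegree_le_of_dvd (minpoly.dvd F α h) (hgm i).ne_zero
        have := hgn i
        omega
      exact wk_geom_zero (fun h => hi (wk_char_eq_one hℓ0 χ hχ hne h))
        (wk_char_pow_eq_one hℓ0 χ hχ hne)
    rw [hsub]
    refine (norm_sum_le_of_le _ (n := fun _ => (ℓ : ℝ) ^ Fintype.card ι) ?_).trans ?_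
    · intro α _
      rw [norm_prod]
      refine (Finset.prod_le_prod (g := fun _ => (ℓ : ℝ)) (fun i _ => norm_nonneg _) ?_).trans ?_
      · intro i _
        refine (norm_sum_le_of_le _ (n := fun _ => (1 : ℝ)) ?_).trans (by simp)
        intro j _
        rw [norm_pow]
        exact pow_le_one₀ (norm_nonneg _) (wk_char_norm_le hℓ0 χ hχ _)
      · simp
    · rw [Finset.sum_const, nsmul_eq_mul]
      refine mul_le_mul_of_nonneg_right ?_ (by positivity)
      have := wk_low_count (F := F) (E := E) hn
      exact_mod_cast this
  have h3 : (Fintype.card E : ℂ) = ∑ α : E, ∏ i, ∑ j ∈ Finset.range ℓ, χ (aeval α (g i)) ^ j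
      - ∑ e ∈ P.erase 0, ∑ α : E, ∏ i, χ (aeval α (g i)) ^ e i := by
    rw [← key]; ring
  calc (Fintype.card E : ℝ) = ‖(Fintype.card E : ℂ)‖ := by simp
    _ ≤ _ := by rw [h3]; exact norm_sub_le _ _
    _ ≤ _ := add_le_add hright hrest


end

theorem exists_alpha_all_ell_th_powers
    {F E : Type*} [Field F] [Fintype F] [Field E] [Fintype E] [Algebra F E]
    (q n d ℓ : ℕ) (hq : IsPrimePow q)
    (hcardF : Fintype.card F = q) (hcardE : Fintype.card E = q ^ n)
    (hn : 1 < n) (hd : 1 ≤ d) (hdn : d < n)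
    (hℓ : 1 < ℓ) (hdvd : ℓ ∣ q ^ n - 1)
    (hcond : 2 * (d : ℝ) + 2 * ((irredDvdSet F d).ncard + 1) * (Real.log ℓ / Real.log q)
      ≤ (n : ℝ)) :
    ∃ α : E, (minpoly F α).natDegree = n ∧
      ∀ g ∈ irredDvdSet F d, ∃ γ : Eˣ, (γ : E) ^ ℓ = Polynomial.aeval α g := by
  classical
  by_contra hcon
  push Not at hcon
  have hq1 : 1 < q := hq.one_lt
  have hfin := wk_irred_finite F hd
  have hmem : ∀ g ∈ hfin.toFinset, g ∈ irredDvdSet F d := fun g hg => by simpa using hg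
  rw [Set.ncard_eq_toFinset_card _ hfin] at hcond
  have hc := wk_cond hq1 hℓ hcond
  have hfr : Module.finrank F E = n := by
    have := Module.card_eq_pow_finrank (K := F) (V := E)
    rw [hcardE, hcardF] at this
    exact (Nat.pow_right_injective hq1 this).symm
  have hsum : ∑ i : hfin.toFinset, (i : Polynomial F).natDegree ≤ q ^ d := by
    have h := wk_irred_sum hd hfin.toFinset hmem
    rw [hcardF] at h
    rwa [Finset.sum_coe_sort hfin.toFinset (fun g => g.natDegree)]
  have hmain := wk_final_count (F := F) (E := E) (ι := hfin.toFinset) (n := n) (ℓ := ℓ) (D := q ^ d)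
    hfr hℓ (by rw [hcardE]; exact hdvd) (fun i => (i : Polynomial F)) Subtype.val_injective
    (fun i => (hmem _ i.2).1) (fun i => (hmem _ i.2).2.1)
    (fun i => (Nat.le_of_dvd (by omega) (hmem _ i.2).2.2).trans_lt hdn) hsum (by
      intro α hα
      obtain ⟨g, hg, hgn⟩ := hcon α hα
      refine ⟨⟨g, by simpa using hg⟩, ?_⟩
      rintro ⟨γ, hγ⟩
      exact hgn γ hγ)
  rw [hcardE, hcardF, Fintype.card_coe] at hmain
  push_cast at hmain
  set k := hfin.toFinset.card
  set s := √((q : ℝ) ^ n) with hs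
  have hq' : (2 : ℝ) ≤ q := by exact_mod_cast hq1
  have hℓ' : (2 : ℝ) ≤ ℓ := by exact_mod_cast hℓ
  have hss : s * s = (q : ℝ) ^ n := Real.mul_self_sqrt (by positivity)
  have hspos : 0 < s := Real.sqrt_pos.2 (by positivity)
  have hlow : (q : ℝ) ^ (n / 2) ≤ s := by
    refine Real.le_sqrt_of_sq_le ?_
    rw [← pow_mul]
    exact pow_le_pow_right₀ (by linarith) (by omega)
  have hD1 : ((q ^ d - 1 : ℕ) : ℝ) = (q : ℝ) ^ d - 1 := by
    rw [Nat.cast_sub (Nat.one_le_pow _ _ (by omega))]; push_cast; rfl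
  have hD2 : (2 : ℝ) ≤ (q : ℝ) ^ d :=
    hq'.trans (le_self_pow₀ (by linarith) (by omega))
  have hLk : (1 : ℝ) ≤ (ℓ : ℝ) ^ k := one_le_pow₀ (by linarith)
  rw [hD1, ← hss] at hmain
  rw [pow_succ] at hc
  generalize (q : ℝ) ^ d = D at *
  generalize (ℓ : ℝ) ^ k = K at *
  have h1 : 2 * (q : ℝ) ^ (n / 2) * K ≤ 2 * s * K := by gcongr
  have h2 : s * s ≤ s * (2 * K + (K - 1) * (D - 1)) := by nlinarith
  have h3 : s ≤ 2 * K + (K - 1) * (D - 1) := le_of_mul_le_mul_left h2 hspos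
  have h4 : D * (K * 2) ≤ D * (K * ℓ) := by gcongr
  nlinarith [mul_nonneg (sub_nonneg.2 hLk) (by linarith : (0:ℝ) ≤ D - 1)]
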